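/- Let q ∈ [1,∞) and let γ = (γ_1,…,γ_d) satisfy 1 = γ_1 = … = γ_ν < γ_{ν+1} ≤ … ≤ γ_d. There exists a constant C(q,γ) such that for all n ∈ ℕ and all f ∈ T(Q_n^γ) one has ‖f‖_∞ ≤ C(q,γ)·2^{n/q}·n^{(ν−1)(1−1/q)}·‖f‖_q. -/

import Mathlib

noncomputable section
open MeasureTheory

/-- The fundamental cell `[0, 2π)^d` of the torus `𝕋^d`. -/
def torusCell (d : ℕ) : Set (Fin d → ℝ) := Set.univ.pi fun _ => Set.Ico 0 (2 * Real.pi)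

/-- Normalized Lebesgue (probability) measure on the torus `𝕋^d = [0,2π)^d`. -/
def torusMeasure (d : ℕ) : Measure (Fin d → ℝ) :=
  (ENNReal.ofReal ((2 * Real.pi) ^ d))⁻¹ • (volume.restrict (torusCell d))

/-- The `L_q` norm on the torus with respect to the normalized Lebesgue measure. -/
def torusLq (d : ℕ) (q : ℝ) {E : Type*} [NormedAddCommGroup E] (f : (Fin d → ℝ) → E) : ℝ :=
  (∫ x, ‖f x‖ ^ q ∂(torusMeasure d)) ^ (1 / q)

/-- The uniform norm on the torus. -/
def torusSupC (d : ℕ) (f : (Fin d → ℝ) → ℂ) : ℝ := ⨆ x : torusCell d, ‖f x.1‖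

/-- The step hyperbolic cross `Q_n^γ = ∪_{s : (γ,s) ≤ n} ρ(s)` where
`ρ(s) = {k : ⌊2^{s_j-1}⌋ ≤ |k_j| < 2^{s_j}}`. -/
def hyperbolicCross (d : ℕ) (γ : Fin d → ℝ) (n : ℕ) : Set (Fin d → ℤ) :=
  {k | ∃ s : Fin d → ℕ, (∑ j, γ j * (s j : ℝ)) ≤ (n : ℝ) ∧
    ∀ j, ⌊(2 : ℝ) ^ ((s j : ℤ) - 1)⌋ ≤ |k j| ∧ |k j| < 2 ^ (s j)}

/-- `f` is a trigonometric polynomial with frequencies in `Q`. -/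
def IsTrigPoly (d : ℕ) (Q : Set (Fin d → ℤ)) (f : (Fin d → ℝ) → ℂ) : Prop :=
  ∃ F : Finset (Fin d → ℤ), ↑F ⊆ Q ∧ ∃ c : (Fin d → ℤ) → ℂ,
    ∀ x, f x = ∑ k ∈ F, c k * Complex.exp (Complex.I * ∑ j, (k j : ℂ) * (x j : ℂ))

section HcPart1
theorem hc_geom_le {r : ℝ} {n : ℕ} (h0 : 0 ≤ r) (h1 : r < 1) :
    ∑ i ∈ Finset.range n, r ^ i ≤ (1 - r)⁻¹ := by
  rw [← tsum_geometric_of_lt_one h0 h1]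
  exact (summable_geometric_of_lt_one h0 h1).sum_le_tsum _ (fun i _ => by positivity)

theorem hc_sum_union_le (s t : Finset ℕ) (f : ℕ → ℝ) (hf : ∀ a, 0 ≤ f a) :
    ∑ a ∈ s ∪ t, f a ≤ ∑ a ∈ s, f a + ∑ a ∈ t, f a := by
  rw [← Finset.sum_union_inter]
  exact le_add_of_nonneg_right (Finset.sum_nonneg fun a _ => hf a)

theorem hc_geom_rank (W : Finset ℕ) (r : ℝ) (h0 : 0 ≤ r) (h1 : r < 1) :
    ∑ a ∈ W, r ^ (W.filter (· < a)).card ≤ (1 - r)⁻¹ := by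
  have key : ∑ a ∈ W, r ^ (W.filter (· < a)).card = ∑ i ∈ Finset.range W.card, r ^ i := by
    induction W using Finset.induction_on_max with
    | empty => simp
    | insert a s hs ih =>
      have ha : a ∉ s := fun h => lt_irrefl _ (hs a h)
      rw [Finset.sum_insert ha, Finset.card_insert_of_notMem ha, Finset.sum_range_succ, ← ih, add_comm]
      congr 1
      · refine Finset.sum_congr rfl fun b hb => ?_
        congr 2
        rw [Finset.filter_insert, if_neg (not_lt.2 (hs b hb).le)]
      · congr 2
        rw [Finset.filter_insert, if_neg (lt_irrefl a)]
        exact Finset.filter_true_of_mem hs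
  rw [key]
  exact hc_geom_le h0 h1
theorem hc_sum_up (β s : ℝ) (hβ : 0 < β) (hs : 0 < s) :
    ∃ C : ℝ, 0 ≤ C ∧ ∀ τ : ℝ, 0 ≤ τ → ∀ m : ℕ,
      ∑ a ∈ (Finset.range (m + 1)).filter (fun a => β < 2 ^ a * τ), ((2 : ℝ) ^ a * τ) ^ (-s) ≤ C := by
  have hr : (2 : ℝ) ^ (-s) < 1 := Real.rpow_lt_one_of_one_lt_of_neg (by norm_num) (by linarith)
  refine ⟨β ^ (-s) * (1 - (2 : ℝ) ^ (-s))⁻¹, ?_, ?_⟩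
  · have : 0 < 1 - (2 : ℝ) ^ (-s) := by linarith
    positivity
  intro τ hτ m
  set W := (Finset.range (m + 1)).filter (fun a => β < 2 ^ a * τ) with hW
  calc ∑ a ∈ W, ((2 : ℝ) ^ a * τ) ^ (-s)
      ≤ ∑ a ∈ W, β ^ (-s) * ((2 : ℝ) ^ (-s)) ^ (W.filter (· < a)).card := by
        refine Finset.sum_le_sum fun a ha => ?_
        have hne : W.Nonempty := ⟨a, ha⟩
        set a0 := W.min' hne with ha0
        have h0 : a0 ∈ W := W.min'_mem hne
        have h1 : β < 2 ^ a0 * τ := (Finset.mem_filter.1 h0).2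
        have hle : a0 ≤ a := W.min'_le a ha
        have hc : (W.filter (· < a)).card ≤ a - a0 := by
          rw [← Nat.card_Ico]
          refine Finset.card_le_card fun b hb => ?_
          rw [Finset.mem_filter] at hb
          exact Finset.mem_Ico.2 ⟨W.min'_le b hb.1, hb.2⟩
        set k := (W.filter (· < a)).card
        have h2 : β * 2 ^ k ≤ 2 ^ a * τ := by
          have : (2 : ℝ) ^ k ≤ 2 ^ (a - a0) := pow_le_pow_right₀ (by norm_num) hc
          calc β * 2 ^ k ≤ (2 ^ a0 * τ) * 2 ^ (a - a0) := by gcongr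
            _ = 2 ^ (a0 + (a - a0)) * τ := by rw [pow_add]; ring
            _ = _ := by rw [Nat.add_sub_cancel' hle]
        calc ((2 : ℝ) ^ a * τ) ^ (-s) ≤ (β * 2 ^ k) ^ (-s) :=
              Real.rpow_le_rpow_of_nonpos (by positivity) h2 (by linarith)
          _ = _ := by
              rw [Real.mul_rpow hβ.le (by positivity), ← Real.rpow_natCast, ← Real.rpow_natCast,
                ← Real.rpow_mul (by norm_num), ← Real.rpow_mul (by norm_num), mul_comm (-s)]
    _ ≤ _ := by
        rw [← Finset.mul_sum]
        exact mul_le_mul_of_nonneg_left (hc_geom_rank _ _ (by positivity) hr) (by positivity)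

theorem hc_sum_down (β s : ℝ) (hβ : 0 < β) (hs : 0 < s) :
    ∃ C : ℝ, 0 ≤ C ∧ ∀ τ : ℝ, 0 ≤ τ → ∀ m : ℕ,
      ∑ a ∈ (Finset.range (m + 1)).filter (fun a => 2 ^ a * τ ≤ β), ((2 : ℝ) ^ a * τ) ^ s ≤ C := by
  have hr : 1 < (2 : ℝ) ^ s := Real.one_lt_rpow (by norm_num) hs
  have hr' : 0 < (2 : ℝ) ^ s - 1 := by linarith
  refine ⟨β ^ s * (2 ^ s / (2 ^ s - 1)), by positivity, ?_⟩
  intro τ hτ m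
  induction m with
  | zero =>
    simp only [zero_add, Finset.range_one, Finset.filter_singleton]
    split_ifs with h
    · rw [Finset.sum_singleton]
      have h1 : ((2 : ℝ) ^ 0 * τ) ^ s ≤ β ^ s := Real.rpow_le_rpow (by positivity) h hs.le
      have h2 : 1 ≤ (2 : ℝ) ^ s / (2 ^ s - 1) := by rw [le_div_iff₀ hr']; linarith
      exact h1.trans (le_mul_of_one_le_right (by positivity) h2)
    · rw [Finset.sum_empty]; positivity
  | succ m ih =>
    by_cases h : 2 ^ (m + 1) * τ ≤ β
    · have hsub : ∑ a ∈ (Finset.range (m + 1 + 1)).filter (fun a => 2 ^ a * τ ≤ β), ((2 : ℝ) ^ a * τ) ^ s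
          ≤ ∑ a ∈ Finset.range (m + 1 + 1), ((2 : ℝ) ^ s) ^ a * τ ^ s := by
        refine (Finset.sum_le_sum_of_subset_of_nonneg (Finset.filter_subset _ _)
          (fun _ _ _ => by positivity)).trans (Finset.sum_le_sum fun a _ => ?_)
        rw [Real.mul_rpow (by positivity) hτ, ← Real.rpow_natCast, ← Real.rpow_natCast,
                ← Real.rpow_mul (by norm_num), ← Real.rpow_mul (by norm_num), mul_comm s]
      refine hsub.trans ?_
      rw [← Finset.sum_mul, geom_sum_eq hr.ne']
      have h1 : ((2 : ℝ) ^ (m + 1) * τ) ^ s ≤ β ^ s := Real.rpow_le_rpow (by positivity) h hs.le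
      rw [Real.mul_rpow (by positivity) hτ] at h1
      have h2 : ((2 : ℝ) ^ (m + 1)) ^ s = (2 ^ s) ^ (m + 1) := by
        rw [← Real.rpow_natCast, ← Real.rpow_natCast,
                ← Real.rpow_mul (by norm_num), ← Real.rpow_mul (by norm_num), mul_comm s]
      rw [h2] at h1
      rw [div_mul_eq_mul_div, ← mul_div_assoc]
      refine div_le_div_of_nonneg_right ?_ hr'.le
      have h3 : 0 ≤ τ ^ s := by positivity
      rw [pow_succ ((2 : ℝ) ^ s) (m + 1)]
      nlinarith
    · rw [Finset.range_add_one, Finset.filter_insert, if_neg h]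
      exact ih

theorem hc_off_window (A δ β : ℝ) (hA : 0 ≤ A) (hδ : 0 < δ) (hβ : 0 < β) :
    ∃ C : ℝ, 0 ≤ C ∧ ∀ τ τ' : ℝ, 0 ≤ τ → 0 ≤ τ' → ∀ g u : ℕ → ℝ,
      (∀ a, 0 ≤ g a) → (∀ a, g a ≤ 1) → (∀ a, g a * (2 ^ a * τ) ≤ 2) →
      (∀ a, 0 ≤ u a) → (∀ a, u a ≤ A) → (∀ a, u a * (2 ^ a * τ') ^ δ ≤ A) → ∀ m : ℕ,
      ∑ a ∈ (Finset.range (m + 1)).filter (fun a => ¬ (2 ^ a * τ ≤ β ∧ 2 ^ (m - a) * τ' ≤ β)),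
        g a * u (m - a) ≤ C := by
  obtain ⟨C1, hC1, H1⟩ := hc_sum_up β 1 hβ one_pos
  obtain ⟨C2, hC2, H2⟩ := hc_sum_up β δ hβ hδ
  refine ⟨2 * A * C1 + A * C2, by positivity, ?_⟩
  intro τ τ' hτ hτ' g u hg0 hg1 hg2 hu0 hu1 hu2 m
  have hsub : (Finset.range (m + 1)).filter (fun a => ¬ (2 ^ a * τ ≤ β ∧ 2 ^ (m - a) * τ' ≤ β)) ⊆
      (Finset.range (m + 1)).filter (fun a => β < 2 ^ a * τ) ∪
      (Finset.range (m + 1)).filter (fun a => β < 2 ^ (m - a) * τ') := by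
    intro a ha
    simp only [Finset.mem_filter, Finset.mem_union, not_and_or, not_le] at ha ⊢
    tauto
  refine (Finset.sum_le_sum_of_subset_of_nonneg hsub
    (fun a _ _ => mul_nonneg (hg0 a) (hu0 _))).trans ?_
  refine (hc_sum_union_le _ _ _ (fun a => mul_nonneg (hg0 a) (hu0 _))).trans ?_
  refine add_le_add ?_ ?_
  · calc _ ≤ ∑ a ∈ (Finset.range (m + 1)).filter (fun a => β < 2 ^ a * τ),
            2 * A * ((2 : ℝ) ^ a * τ) ^ (-(1 : ℝ)) := by
          refine Finset.sum_le_sum fun a ha => ?_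
          have hb := (Finset.mem_filter.1 ha).2
          have hp : 0 < (2 : ℝ) ^ a * τ := hβ.trans hb
          rw [Real.rpow_neg_one]
          have : g a ≤ 2 * ((2 : ℝ) ^ a * τ)⁻¹ := by
            rw [← div_eq_mul_inv, le_div_iff₀ hp]; exact hg2 a
          calc g a * u (m - a) ≤ (2 * ((2 : ℝ) ^ a * τ)⁻¹) * A :=
                mul_le_mul this (hu1 _) (hu0 _) (by positivity)
            _ = _ := by ring
      _ ≤ _ := by
          rw [← Finset.mul_sum]
          exact mul_le_mul_of_nonneg_left (H1 τ hτ m) (by positivity)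
  · calc _ ≤ ∑ a ∈ (Finset.range (m + 1)).filter (fun a => β < 2 ^ (m - a) * τ'),
            A * ((2 : ℝ) ^ (m - a) * τ') ^ (-δ) := by
          refine Finset.sum_le_sum fun a ha => ?_
          have hb := (Finset.mem_filter.1 ha).2
          have hp : 0 < (2 : ℝ) ^ (m - a) * τ' := hβ.trans hb
          have : u (m - a) ≤ A * ((2 : ℝ) ^ (m - a) * τ') ^ (-δ) := by
            rw [Real.rpow_neg hp.le, ← div_eq_mul_inv, le_div_iff₀ (by positivity)]
            exact hu2 _
          calc g a * u (m - a) ≤ 1 * u (m - a) := mul_le_mul_of_nonneg_right (hg1 a) (hu0 _)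
            _ ≤ _ := by rw [one_mul]; exact this
      _ = ∑ a ∈ (Finset.range (m + 1)).filter (fun a => β < 2 ^ a * τ'),
            A * ((2 : ℝ) ^ a * τ') ^ (-δ) := by
          rw [Finset.sum_filter, Finset.sum_filter, ← Finset.sum_range_reflect]
          refine Finset.sum_congr rfl fun a ha => ?_
          have : a ≤ m := Nat.lt_succ_iff.1 (Finset.mem_range.1 ha)
          have e : m - (m + 1 - 1 - a) = a := by omega
          rw [e]
      _ ≤ _ := by
          rw [← Finset.mul_sum]
          exact mul_le_mul_of_nonneg_left (H2 τ' hτ' m) (by positivity)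
theorem hc_full_decay (δ : ℝ) (h0 : 0 < δ) (h1 : δ < 1) :
    ∃ C : ℝ, 0 ≤ C ∧ ∀ τ : ℝ, 0 ≤ τ → ∀ g : ℕ → ℝ,
      (∀ a, 0 ≤ g a) → (∀ a, g a ≤ 1) → (∀ a, g a * (2 ^ a * τ) ≤ 2) → ∀ m : ℕ,
      ∑ a ∈ Finset.range (m + 1), g a * (2 ^ a * τ) ^ δ ≤ C := by
  obtain ⟨C1, hC1, H1⟩ := hc_sum_down 1 δ one_pos h0
  obtain ⟨C2, hC2, H2⟩ := hc_sum_up 1 (1 - δ) one_pos (by linarith)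
  refine ⟨C1 + 2 * C2, by positivity, ?_⟩
  intro τ hτ g hg0 hg1 hg2 m
  rw [← Finset.sum_filter_add_sum_filter_not _ (fun a => (2 : ℝ) ^ a * τ ≤ 1)]
  refine add_le_add ((Finset.sum_le_sum fun a _ => ?_).trans (H1 τ hτ m)) ?_
  · exact mul_le_of_le_one_left (by positivity) (hg1 a)
  · simp only [not_le]
    calc _ ≤ ∑ a ∈ (Finset.range (m + 1)).filter (fun a => 1 < (2 : ℝ) ^ a * τ),
            2 * ((2 : ℝ) ^ a * τ) ^ (-(1 - δ)) := by
          refine Finset.sum_le_sum fun a ha => ?_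
          have hb := (Finset.mem_filter.1 ha).2
          have hp : 0 < (2 : ℝ) ^ a * τ := one_pos.trans hb
          have e : ((2 : ℝ) ^ a * τ) ^ δ = ((2 : ℝ) ^ a * τ) * ((2 : ℝ) ^ a * τ) ^ (-(1 - δ)) := by
            nth_rewrite 2 [← Real.rpow_one ((2 : ℝ) ^ a * τ)]
            rw [← Real.rpow_add hp]; congr 1; ring
          rw [e, ← mul_assoc]
          exact mul_le_mul_of_nonneg_right (hg2 a) (by positivity)
      _ ≤ _ := by
          rw [← Finset.mul_sum]
          exact mul_le_mul_of_nonneg_left (H2 τ hτ m) (by positivity)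

theorem hc_bad_card (β τ : ℝ) (hβ : 0 < β) (hβ1 : β ≤ 1) (hτ : 0 ≤ τ) (m : ℕ) :
    (2 : ℝ) ^ ((Finset.range (m + 1)).filter (fun a => β < 2 ^ a * τ)).card ≤
      2 / β * max 1 (2 ^ m * τ) := by
  set W := (Finset.range (m + 1)).filter (fun a => β < 2 ^ a * τ) with hW
  rcases W.eq_empty_or_nonempty with h | hne
  · rw [h]
    simp only [Finset.card_empty, pow_zero]
    have : 1 ≤ 2 / β := by rw [le_div_iff₀ hβ]; linarith
    nlinarith [le_max_left 1 (2 ^ m * τ)]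
  · set a0 := W.min' hne with ha0
    have h0 : a0 ∈ W := W.min'_mem hne
    have h1 : β < 2 ^ a0 * τ := (Finset.mem_filter.1 h0).2
    have hle : a0 < m + 1 := Finset.mem_range.1 (Finset.mem_filter.1 h0).1
    have hc : W.card ≤ m + 1 - a0 := by
      rw [← Nat.card_Ico]
      refine Finset.card_le_card fun b hb => ?_
      exact Finset.mem_Ico.2 ⟨W.min'_le b hb, Finset.mem_range.1 (Finset.mem_filter.1 hb).1⟩
    calc (2 : ℝ) ^ W.card ≤ 2 ^ (m + 1 - a0) := pow_le_pow_right₀ (by norm_num) hc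
      _ ≤ 2 / β * (2 ^ m * τ) := by
          rw [div_mul_eq_mul_div, le_div_iff₀ hβ]
          calc (2 : ℝ) ^ (m + 1 - a0) * β ≤ 2 ^ (m + 1 - a0) * (2 ^ a0 * τ) := by gcongr
            _ = 2 ^ (m + 1 - a0 + a0) * τ := by rw [pow_add]; ring
            _ = _ := by rw [Nat.sub_add_cancel hle.le, pow_succ]; ring
      _ ≤ _ := by gcongr; exact le_max_right _ _

theorem hc_window_card (β τ τ' : ℝ) (hβ : 0 < β) (hβ1 : β ≤ 1) (hτ : 0 ≤ τ) (hτ' : 0 ≤ τ') (m : ℕ) :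
    (2 : ℝ) ^ m ≤ 2 ^ ((Finset.range (m + 1)).filter
        (fun a => 2 ^ a * τ ≤ β ∧ 2 ^ (m - a) * τ' ≤ β)).card *
      (2 / β * max 1 (2 ^ m * τ)) * (2 / β * max 1 (2 ^ m * τ')) := by
  have h1 := hc_bad_card β τ hβ hβ1 hτ m
  have h2 := hc_bad_card β τ' hβ hβ1 hτ' m
  have h3 : ((Finset.range (m + 1)).filter (fun a => β < 2 ^ (m - a) * τ')).card =
      ((Finset.range (m + 1)).filter (fun a => β < 2 ^ a * τ')).card := by
    rw [Finset.card_filter, Finset.card_filter, ← Finset.sum_range_reflect]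
    refine Finset.sum_congr rfl fun a ha => ?_
    have : a ≤ m := Nat.lt_succ_iff.1 (Finset.mem_range.1 ha)
    have e : m - (m + 1 - 1 - a) = a := by omega
    rw [e]
  rw [← h3] at h2
  set W := (Finset.range (m + 1)).filter (fun a => 2 ^ a * τ ≤ β ∧ 2 ^ (m - a) * τ' ≤ β)
  set W1 := (Finset.range (m + 1)).filter (fun a => β < 2 ^ a * τ)
  set W2 := (Finset.range (m + 1)).filter (fun a => β < 2 ^ (m - a) * τ')
  have hc : m + 1 ≤ W.card + W1.card + W2.card := by
    have : Finset.range (m + 1) ⊆ (W ∪ W1) ∪ W2 := by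
      intro a ha
      simp only [W, W1, W2, Finset.mem_union, Finset.mem_filter, ha, true_and]
      rcases le_or_gt (2 ^ a * τ) β with h | h
      · rcases le_or_gt (2 ^ (m - a) * τ') β with h' | h'
        · exact Or.inl (Or.inl ⟨h, h'⟩)
        · exact Or.inr h'
      · exact Or.inl (Or.inr h)
    have := Finset.card_le_card this
    rw [Finset.card_range] at this
    have a1 := Finset.card_union_le (W ∪ W1) W2
    have a2 := Finset.card_union_le W W1
    omega
  calc (2 : ℝ) ^ m ≤ 2 ^ (W.card + W1.card + W2.card) :=
        pow_le_pow_right₀ (by norm_num) (by omega)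
    _ = 2 ^ W.card * 2 ^ W1.card * 2 ^ W2.card := by rw [pow_add, pow_add]
    _ ≤ _ := by gcongr
end HcPart1

section HcPart2
theorem hc_exp_step (R : ℂ) (N : ℕ) (hN : 1 ≤ N) (h : ‖R‖ ^ 2 ≤ N) (i : ℕ) :
    ‖1 - R / N‖ ^ i ≤ Real.exp (i / N * (-R.re + 1 / 2)) := by
  have hN0 : (0 : ℝ) < N := by exact_mod_cast hN
  have h1 : ‖1 - R / N‖ ^ 2 ≤ Real.exp (2 * ((-R.re + 1 / 2) / N)) := by
    have e : ‖1 - R / N‖ ^ 2 = 1 - 2 * R.re / N + ‖R‖ ^ 2 / N ^ 2 := by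
      have : (1 - R / N : ℂ) = ((1 - R.re / N : ℝ) : ℂ) + ((-R.im / N : ℝ) : ℂ) * Complex.I := by
        apply Complex.ext <;> simp [Complex.div_re, Complex.div_im, Complex.normSq] <;> field_simp
      rw [this, ← Complex.normSq_eq_norm_sq, ← Complex.normSq_eq_norm_sq, Complex.normSq_add_mul_I,
        Complex.normSq_apply]
      field_simp; ring
    rw [e]
    have h2 : ‖R‖ ^ 2 / N ^ 2 ≤ 1 / N := by
      rw [div_le_div_iff₀ (by positivity) hN0]
      nlinarith
    have h3 := Real.add_one_le_exp (2 * ((-R.re + 1 / 2) / N))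
    have e2 : 2 * ((-R.re + 1 / 2) / N) = 1 / N - 2 * R.re / N := by field_simp; ring
    linarith
  have h2 : ‖1 - R / N‖ ≤ Real.exp ((-R.re + 1 / 2) / N) := by
    refine (le_abs_self _).trans (abs_le_of_sq_le_sq ?_ (Real.exp_pos _).le)
    rw [← Real.exp_nat_mul]; exact_mod_cast h1
  calc ‖1 - R / N‖ ^ i ≤ Real.exp ((-R.re + 1 / 2) / N) ^ i := by gcongr
    _ = _ := by rw [← Real.exp_nat_mul]; congr 1; ring


theorem hc_exp_full (R : ℂ) (N : ℕ) (hN : 1 ≤ N) (h : ‖R‖ ^ 2 ≤ N) (c : ℝ) (hc : c ≤ R.re) :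
    ‖(1 - R / N) ^ N‖ ≤ Real.exp (-c + 1 / 2) := by
  have hN0 : (0 : ℝ) < N := by exact_mod_cast hN
  rw [norm_pow]
  refine (hc_exp_step R N hN h N).trans ?_
  rw [div_self hN0.ne', one_mul]
  exact Real.exp_le_exp.2 (by linarith)

theorem hc_exp_sub (R : ℂ) (N : ℕ) (hN : 1 ≤ N) (h : ‖R‖ ^ 2 ≤ N) (c : ℝ) (hc0 : 0 ≤ c) (hc : -c ≤ R.re) :
    ‖1 - (1 - R / N) ^ N‖ ≤ ‖R‖ * Real.exp (c + 1 / 2) := by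
  have hN0 : (0 : ℝ) < N := by exact_mod_cast hN
  have hNc : (N : ℂ) ≠ 0 := by exact_mod_cast hN0.ne'
  have e : 1 - (1 - R / N) ^ N = R / N * ∑ i ∈ Finset.range N, (1 - R / N) ^ i := by
    have := mul_neg_geom_sum (1 - R / N : ℂ) N
    rw [← this]; ring
  rw [e, norm_mul, norm_div, Complex.norm_natCast]
  have : ‖∑ i ∈ Finset.range N, (1 - R / N) ^ i‖ ≤ N * Real.exp (c + 1 / 2) := by
    refine (norm_sum_le _ _).trans ?_
    calc _ ≤ ∑ i ∈ Finset.range N, Real.exp (c + 1 / 2) := by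
          refine Finset.sum_le_sum fun i hi => ?_
          rw [norm_pow]
          refine (hc_exp_step R N hN h i).trans (Real.exp_le_exp.2 ?_)
          have h1 : (i : ℝ) / N ≤ 1 := by
            rw [div_le_one hN0]; exact_mod_cast (Finset.mem_range.1 hi).le
          have h0 : 0 ≤ (i : ℝ) / N := by positivity
          calc (i : ℝ) / N * (-R.re + 1 / 2) ≤ i / N * (c + 1 / 2) := by gcongr; linarith
            _ ≤ 1 * (c + 1 / 2) := by gcongr
            _ = _ := one_mul _
      _ = _ := by simp
  calc ‖R‖ / N * _ ≤ ‖R‖ / N * (N * Real.exp (c + 1 / 2)) := by gcongr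
    _ = _ := by field_simp

/-- The bounds for the one-dimensional blocks. -/
def HcG (τ : ℝ) (g : ℕ → ℂ) : Prop :=
  (∀ a, ‖g a‖ ≤ 1) ∧ (∀ a, ‖g a‖ * (2 ^ a * τ) ≤ 2) ∧ (∀ a, ‖1 - g a‖ ≤ 2 * (2 ^ a * τ))

/-- The bounds for the helper kernels. -/
def HcV (A δ τ : ℝ) (v : ℕ → ℂ) : Prop :=
  (∀ m, ‖v m‖ ≤ A) ∧ (∀ m, ‖v m‖ * (2 ^ m * τ) ^ δ ≤ A) ∧ (∀ m, ‖1 - v m‖ ≤ A * (2 ^ m * τ) ^ δ)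

theorem hc_beta (A δ : ℝ) (hA : 1 ≤ A) (hδ : 0 < δ) :
    ∃ β : ℝ, 0 < β ∧ β ≤ 1 / 16 ∧ A * β ^ δ ≤ 1 / 8 := by
  refine ⟨min (1 / 16) ((1 / (8 * A)) ^ (1 / δ)), by positivity, min_le_left _ _, ?_⟩
  calc A * (min (1 / 16) ((1 / (8 * A)) ^ (1 / δ))) ^ δ ≤ A * ((1 / (8 * A)) ^ (1 / δ)) ^ δ := by
        gcongr; exact min_le_right _ _
    _ = A * (1 / (8 * A)) := by
        rw [← Real.rpow_mul (by positivity), one_div_mul_cancel hδ.ne', Real.rpow_one]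
    _ ≤ 1 / 8 := by rw [mul_one_div, div_le_div_iff₀ (by positivity) (by norm_num)]; linarith

theorem hc_re_lower (A δ β : ℝ) (hA : 1 ≤ A) (hδ : 0 < δ) (hβ : 0 < β) (hβ1 : β ≤ 1 / 16)
    (hβ2 : A * β ^ δ ≤ 1 / 8) :
    ∃ C : ℝ, 0 ≤ C ∧ ∀ τ τ' : ℝ, 0 ≤ τ → 0 ≤ τ' → ∀ g v : ℕ → ℂ, HcG τ g → HcV A δ τ' v →
      ∀ (m : ℕ) (S : Finset ℕ), S ⊆ Finset.range (m + 1) →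
      1 / 2 * ((S.filter (fun a => 2 ^ a * τ ≤ β ∧ 2 ^ (m - a) * τ' ≤ β)).card : ℝ) - C ≤
        (∑ a ∈ S, g a * v (m - a)).re := by
  obtain ⟨C, hC, H⟩ := hc_off_window A δ β (by linarith) hδ hβ
  refine ⟨C, hC, ?_⟩
  intro τ τ' hτ hτ' g v hg hv m S hS
  have H' := H τ τ' hτ hτ' (fun a => ‖g a‖) (fun a => ‖v a‖) (fun _ => norm_nonneg _) hg.1 hg.2.1
    (fun _ => norm_nonneg _) hv.1 hv.2.1 m
  rw [← Finset.sum_filter_add_sum_filter_not S (fun a => 2 ^ a * τ ≤ β ∧ 2 ^ (m - a) * τ' ≤ β),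
    Complex.add_re, sub_eq_add_neg]
  refine add_le_add ?_ ?_
  · rw [Complex.re_sum, mul_comm, ← nsmul_eq_mul]
    refine Finset.card_nsmul_le_sum _ _ _ fun a ha => ?_
    obtain ⟨h1, h2⟩ := (Finset.mem_filter.1 ha).2
    have h3 : ‖1 - g a‖ ≤ 1 / 8 := by have := hg.2.2 a; linarith
    have h4 : ‖1 - v (m - a)‖ ≤ 1 / 8 := by
      refine (hv.2.2 _).trans (le_trans ?_ hβ2)
      gcongr
    have e : g a * v (m - a) = 1 - (1 - g a) - (1 - v (m - a)) + (1 - g a) * (1 - v (m - a)) := by ring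
    have h5 : ‖(1 - g a) * (1 - v (m - a))‖ ≤ 1 / 8 * (1 / 8) := by
      rw [norm_mul]; gcongr
    have a1 := Complex.re_le_norm (1 - g a)
    have a2 := Complex.re_le_norm (1 - v (m - a))
    have a3 := (abs_le.1 (Complex.abs_re_le_norm ((1 - g a) * (1 - v (m - a))))).1
    rw [e, Complex.add_re, Complex.sub_re, Complex.sub_re, Complex.one_re]
    linarith
  · have h1 : ‖∑ a ∈ S.filter (fun a => ¬ (2 ^ a * τ ≤ β ∧ 2 ^ (m - a) * τ' ≤ β)), g a * v (m - a)‖ ≤ C := by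
      refine (norm_sum_le _ _).trans (le_trans ?_ H')
      refine (Finset.sum_le_sum_of_subset_of_nonneg (Finset.filter_subset_filter _ hS)
        (fun _ _ _ => norm_nonneg _)).trans (Finset.sum_le_sum fun a _ => (norm_mul _ _).le)
    have := (abs_le.1 (Complex.abs_re_le_norm (∑ a ∈ S.filter (fun a => ¬ (2 ^ a * τ ≤ β ∧ 2 ^ (m - a) * τ' ≤ β)), g a * v (m - a)))).1
    linarith

theorem hc_pow_split (τ τ' δ : ℝ) (hτ : 0 ≤ τ) (hτ' : 0 ≤ τ') (m a : ℕ) (h : a ≤ m) :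
    ((2 : ℝ) ^ m * (τ * τ')) ^ δ = (2 ^ a * τ) ^ δ * (2 ^ (m - a) * τ') ^ δ := by
  rw [← Real.mul_rpow (by positivity) (by positivity)]
  congr 1
  nth_rewrite 1 [← Nat.add_sub_cancel' h]
  rw [pow_add]; ring

theorem hc_helper_step (A δ : ℝ) (hA : 1 ≤ A) (hδ : 0 < δ) (hδ1 : δ ≤ 1 / 2) :
    ∃ A' : ℝ, 1 ≤ A' ∧ ∀ τ τ' : ℝ, 0 ≤ τ → τ ≤ 1 → 0 ≤ τ' → τ' ≤ 1 → ∀ g v : ℕ → ℂ,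
      HcG τ g → HcV A δ τ' v → ∀ N : ℕ → ℕ, (∀ m, 1 ≤ N m) →
      (∀ m, ‖∑ a ∈ Finset.range (m + 1), g a * v (m - a)‖ ^ 2 ≤ N m) →
      HcV A' δ (τ * τ') (fun m => 1 - (1 - v m) * (1 - g m) *
        (1 - (∑ a ∈ Finset.range (m + 1), g a * v (m - a)) / N m) ^ N m) := by
  obtain ⟨β, hβ, hβ1, hβ2⟩ := hc_beta A δ hA hδ
  obtain ⟨C, hC, HC⟩ := hc_re_lower A δ β hA hδ hβ hβ1 hβ2
  obtain ⟨D, hD, HD⟩ := hc_full_decay δ hδ (by linarith)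
  set K := Real.exp (C + 1 / 2) with hK
  have hK1 : 1 ≤ K := Real.one_le_exp (by linarith)
  set A1 := 1 + (1 + A) * 2 * K
  set A2 := A * D * K + K * (2 * A + 2)
  set A3 := 2 * (1 + A) * K * ((2 / β) * (2 / β)) ^ δ
  have hA1 : 1 ≤ A1 := by simp only [A1]; have : 0 ≤ (1 + A) * 2 * K := by positivity
                          linarith
  have hA2 : 0 ≤ A2 := by positivity
  have hA3 : 0 ≤ A3 := by positivity
  refine ⟨A1 + A2 + A3, by linarith, ?_⟩
  intro τ τ' hτ hτ1 hτ' hτ1' g v hg hv N hN1 hN2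
  have HR := fun m => HC τ τ' hτ hτ' g v hg hv m (Finset.range (m + 1)) (Finset.Subset.refl _)
  have hEcl : ∀ m, ‖1 - (1 - (1 - v m) * (1 - g m) *
        (1 - (∑ a ∈ Finset.range (m + 1), g a * v (m - a)) / N m) ^ N m)‖ ≤ 
        ‖1 - v m‖ * ‖1 - g m‖ * ‖(1 - (∑ a ∈ Finset.range (m + 1), g a * v (m - a)) / N m) ^ N m‖ := by
    intro m
    rw [sub_sub_cancel, norm_mul, norm_mul]
  have hEK : ∀ m, ‖(1 - (∑ a ∈ Finset.range (m + 1), g a * v (m - a)) / N m) ^ N m‖ ≤ K := by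
    intro m
    refine (hc_exp_full _ _ (hN1 m) (hN2 m) (-C) ?_).trans (by rw [neg_neg])
    refine le_trans ?_ (HR m)
    have : (0 : ℝ) ≤ 1 / 2 * (((Finset.range (m + 1)).filter (fun a => 2 ^ a * τ ≤ β ∧ 2 ^ (m - a) * τ' ≤ β)).card : ℝ) := by positivity
    linarith
  have hv1 : ∀ m, ‖1 - v m‖ ≤ 1 + A := fun m => (norm_sub_le _ _).trans (by rw [norm_one]; linarith [hv.1 m])
  have hg1 : ∀ m, ‖1 - g m‖ ≤ 2 := fun m => (norm_sub_le _ _).trans (by rw [norm_one]; linarith [hg.1 m])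
  refine ⟨fun m => ?_, fun m => ?_, fun m => ?_⟩
  · have : ‖1 - (1 - v m) * (1 - g m) *
        (1 - (∑ a ∈ Finset.range (m + 1), g a * v (m - a)) / N m) ^ N m‖ ≤ A1 := by
      refine (norm_sub_le _ _).trans ?_
      rw [norm_one, norm_mul, norm_mul]
      simp only [A1]
      gcongr
      exacts [hv1 m, hg1 m, hEK m]
    linarith
  · set R := ∑ a ∈ Finset.range (m + 1), g a * v (m - a) with hR
    set E := (1 - R / N m) ^ N m with hE
    have hX : 0 ≤ ((2 : ℝ) ^ m * (τ * τ')) ^ δ := by positivity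
    have hER : ‖1 - E‖ ≤ ‖R‖ * K := by
      refine hc_exp_sub _ _ (hN1 m) (hN2 m) C hC ?_
      refine le_trans ?_ (HR m)
      have : (0 : ℝ) ≤ 1 / 2 * (((Finset.range (m + 1)).filter (fun a => 2 ^ a * τ ≤ β ∧ 2 ^ (m - a) * τ' ≤ β)).card : ℝ) := by positivity
      linarith
    have hRX : ‖R‖ * ((2 : ℝ) ^ m * (τ * τ')) ^ δ ≤ A * D := by
      calc ‖R‖ * ((2 : ℝ) ^ m * (τ * τ')) ^ δ
          ≤ (∑ a ∈ Finset.range (m + 1), ‖g a * v (m - a)‖) * ((2 : ℝ) ^ m * (τ * τ')) ^ δ := by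
            gcongr; exact norm_sum_le _ _
        _ ≤ ∑ a ∈ Finset.range (m + 1), A * (‖g a‖ * (2 ^ a * τ) ^ δ) := by
            rw [Finset.sum_mul]
            refine Finset.sum_le_sum fun a ha => ?_
            rw [hc_pow_split τ τ' δ hτ hτ' m a (Nat.lt_succ_iff.1 (Finset.mem_range.1 ha)), norm_mul]
            calc _ = (‖v (m - a)‖ * (2 ^ (m - a) * τ') ^ δ) * (‖g a‖ * (2 ^ a * τ) ^ δ) := by ring
              _ ≤ _ := by gcongr; exact hv.2.1 _
        _ ≤ A * D := by
            rw [← Finset.mul_sum]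
            gcongr
            exact HD τ hτ (fun a => ‖g a‖) (fun _ => norm_nonneg _) hg.1 hg.2.1 m
    have hp : ‖v m‖ * ((2 : ℝ) ^ m * (τ * τ')) ^ δ ≤ A := by
      refine le_trans ?_ (hv.2.1 m)
      gcongr
      exact mul_le_of_le_one_left hτ' hτ1
    have hq : ‖g m‖ * ((2 : ℝ) ^ m * (τ * τ')) ^ δ ≤ 2 := by
      calc ‖g m‖ * ((2 : ℝ) ^ m * (τ * τ')) ^ δ ≤ ‖g m‖ * ((2 : ℝ) ^ m * τ) ^ δ := by
            gcongr; exact mul_le_of_le_one_right hτ hτ1'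
        _ ≤ 2 := by
            rcases le_total ((2 : ℝ) ^ m * τ) 1 with h | h
            · have : ((2 : ℝ) ^ m * τ) ^ δ ≤ 1 := Real.rpow_le_one (by positivity) h hδ.le
              have := mul_le_mul (hg.1 m) this (by positivity) (by norm_num)
              linarith
            · refine le_trans ?_ (hg.2.1 m)
              gcongr
              calc ((2 : ℝ) ^ m * τ) ^ δ ≤ ((2 : ℝ) ^ m * τ) ^ (1 : ℝ) :=
                    Real.rpow_le_rpow_of_exponent_le h (by linarith)
                _ = _ := Real.rpow_one _
    have e : 1 - (1 - v m) * (1 - g m) * E = (1 - E) + E * (v m + g m - v m * g m) := by ring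
    have hb : ‖v m + g m - v m * g m‖ ≤ ‖v m‖ + ‖g m‖ + ‖v m‖ := by
      refine (norm_sub_le _ _).trans (add_le_add (norm_add_le _ _) ?_)
      rw [norm_mul]; exact mul_le_of_le_one_right (norm_nonneg _) (hg.1 m)
    have : ‖1 - (1 - v m) * (1 - g m) * E‖ * ((2 : ℝ) ^ m * (τ * τ')) ^ δ ≤ A2 := by
      rw [e]
      calc _ ≤ (‖R‖ * K + K * (‖v m‖ + ‖g m‖ + ‖v m‖)) * ((2 : ℝ) ^ m * (τ * τ')) ^ δ := by
            gcongr
            refine (norm_add_le _ _).trans (add_le_add hER ?_)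
            rw [norm_mul]
            gcongr
            exact hEK m
        _ = (‖R‖ * ((2 : ℝ) ^ m * (τ * τ')) ^ δ) * K + K * (2 * (‖v m‖ * ((2 : ℝ) ^ m * (τ * τ')) ^ δ)
            + ‖g m‖ * ((2 : ℝ) ^ m * (τ * τ')) ^ δ) := by ring
        _ ≤ _ := by simp only [A2]; gcongr
    linarith
  · refine (hEcl m).trans ?_
    set R := ∑ a ∈ Finset.range (m + 1), g a * v (m - a) with hR
    set E := (1 - R / N m) ^ N m with hE
    set W := (Finset.range (m + 1)).filter (fun a => 2 ^ a * τ ≤ β ∧ 2 ^ (m - a) * τ' ≤ β) with hW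
    have hwc := hc_window_card β τ τ' hβ (by linarith) hτ hτ' m
    rw [← hW] at hwc
    have hE1 : ‖E‖ ≤ K * ((2 : ℝ) ^ W.card) ^ (-δ) := by
      refine (hc_exp_full _ _ (hN1 m) (hN2 m) _ (HR m)).trans ?_
      have : -(1 / 2 * (W.card : ℝ) - C) + 1 / 2 = (C + 1 / 2) + -(1 / 2 * (W.card : ℝ)) := by ring
      rw [this, Real.exp_add]
      gcongr
      rw [← Real.rpow_natCast, ← Real.rpow_mul (by norm_num), Real.rpow_def_of_pos (by norm_num)]
      apply Real.exp_le_exp.2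
      have l2 : Real.log 2 ≤ 1 := by have := Real.log_two_lt_d9; linarith
      have l0 : 0 ≤ Real.log 2 := Real.log_nonneg (by norm_num)
      have : Real.log 2 * ((W.card : ℝ) * δ) ≤ 1 * ((W.card : ℝ) * (1 / 2)) := by gcongr
      linarith
    set M := max 1 ((2 : ℝ) ^ m * τ)
    set M' := max 1 ((2 : ℝ) ^ m * τ')
    set μ := min 1 ((2 : ℝ) ^ m * τ)
    set μ' := min 1 ((2 : ℝ) ^ m * τ')
    have hM : 1 ≤ M := le_max_left _ _
    have hM' : 1 ≤ M' := le_max_left _ _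
    have hμ : 0 ≤ μ := le_min zero_le_one (by positivity)
    have hμ' : 0 ≤ μ' := le_min zero_le_one (by positivity)
    have hMμ : μ * M = 2 ^ m * τ := by simp only [μ, M]; rw [min_mul_max, one_mul]
    have hMμ' : μ' * M' = 2 ^ m * τ' := by simp only [μ', M']; rw [min_mul_max, one_mul]
    have hv2 : ‖1 - v m‖ ≤ (1 + A) * μ' ^ δ := by
      rcases le_total 1 ((2 : ℝ) ^ m * τ') with h | h
      · simp only [μ']; rw [min_eq_left h, Real.one_rpow, mul_one]; exact hv1 m
      · simp only [μ']; rw [min_eq_right h]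
        refine (hv.2.2 m).trans ?_
        gcongr; linarith
    have hg2 : ‖1 - g m‖ ≤ 2 * μ ^ δ := by
      rcases le_total 1 ((2 : ℝ) ^ m * τ) with h | h
      · simp only [μ]; rw [min_eq_left h, Real.one_rpow, mul_one]; exact hg1 m
      · simp only [μ]; rw [min_eq_right h]
        refine (hg.2.2 m).trans ?_
        gcongr
        rcases eq_or_lt_of_le (show 0 ≤ (2 : ℝ) ^ m * τ by positivity) with h0 | h0
        · rw [← h0]; exact Real.rpow_nonneg le_rfl _
        · calc (2 : ℝ) ^ m * τ = ((2 : ℝ) ^ m * τ) ^ (1 : ℝ) := (Real.rpow_one _).symm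
            _ ≤ _ := Real.rpow_le_rpow_of_exponent_ge h0 h (by linarith)
    have hk : ((2 : ℝ) ^ W.card) ^ (-δ) ≤ ((2 / β) * (2 / β)) ^ δ * (M * M' / 2 ^ m) ^ δ := by
      rw [← Real.mul_rpow (by positivity) (by positivity), Real.rpow_neg (by positivity),
        ← Real.inv_rpow (by positivity)]
      refine Real.rpow_le_rpow (by positivity) ?_ hδ.le
      rw [inv_le_iff_one_le_mul₀ (by positivity), ← mul_div_assoc, div_mul_eq_mul_div, le_div_iff₀ (by positivity)]
      linarith
    have : ‖1 - v m‖ * ‖1 - g m‖ * ‖E‖ ≤ A3 * (2 ^ m * (τ * τ')) ^ δ := by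
      calc _ ≤ ((1 + A) * μ' ^ δ) * (2 * μ ^ δ) * (K * (((2 / β) * (2 / β)) ^ δ * (M * M' / 2 ^ m) ^ δ)) := by
            gcongr
            exact hE1.trans (by gcongr)
        _ = A3 * (μ' ^ δ * μ ^ δ * (M * M' / 2 ^ m) ^ δ) := by simp only [A3]; ring
        _ = _ := by
            rw [← Real.mul_rpow (by positivity) (by positivity), ← Real.mul_rpow (by positivity) (by positivity)]
            congr 2
            calc μ' * μ * (M * M' / 2 ^ m) = (μ * M) * (μ' * M') / 2 ^ m := by ring
              _ = _ := by rw [hMμ, hMμ']; field_simp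
    refine this.trans ?_
    gcongr
    linarith

theorem hc_kernel_step (A δv U δ : ℝ) (hA : 1 ≤ A) (hδv : 0 < δv) (hU : 0 ≤ U) (hδ : 0 < δ) (hδ1 : δ < 1) :
    ∃ U' : ℝ, 0 ≤ U' ∧ ∀ τ τ' : ℝ, 0 ≤ τ → 0 ≤ τ' → ∀ g v : ℕ → ℂ,
      HcG τ g → HcV A δv τ' v → ∀ u : ℕ → ℝ, (∀ a, 0 ≤ u a) → (∀ a, u a ≤ U) →
      (∀ a, u a * (2 ^ a * τ') ^ δ ≤ U) → ∀ n N : ℕ, 1 ≤ N →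
      (∀ a ∈ Finset.range (n + 1), ‖∑ b ∈ Finset.range a, g b * v (n - b)‖ ^ 2 ≤ N) →
      (∑ a ∈ Finset.range (n + 1), ‖g a‖ * u (n - a) *
        ‖(1 - (∑ b ∈ Finset.range a, g b * v (n - b)) / N) ^ N‖ ≤ U') ∧
      (∑ a ∈ Finset.range (n + 1), ‖g a‖ * u (n - a) *
        ‖(1 - (∑ b ∈ Finset.range a, g b * v (n - b)) / N) ^ N‖) * (2 ^ n * (τ * τ')) ^ δ ≤ U' := by
  obtain ⟨β, hβ, hβ1, hβ2⟩ := hc_beta A δv hA hδv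
  obtain ⟨C, hC, HC⟩ := hc_re_lower A δv β hA hδv hβ hβ1 hβ2
  obtain ⟨D, hD, HD⟩ := hc_full_decay δ hδ (by linarith)
  obtain ⟨B, hB, HB⟩ := hc_off_window U δ β hU hδ hβ
  set K := Real.exp (C + 1 / 2) with hK
  have hr : Real.exp (-(1 / 2)) < 1 := by
    rw [← Real.exp_zero]; exact Real.exp_lt_exp.2 (by norm_num)
  set r := Real.exp (-(1 / 2)) with hr'
  have hr2 : 0 < 1 - r := by linarith
  refine ⟨(U * K * (1 - r)⁻¹ + B * K) + U * D * K, by positivity, ?_⟩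
  intro τ τ' hτ hτ' g v hg hv u hu0 hu1 hu2 n N hN1 hN2
  set W := (Finset.range (n + 1)).filter (fun a => 2 ^ a * τ ≤ β ∧ 2 ^ (n - a) * τ' ≤ β) with hW
  have hF : ∀ a ∈ Finset.range (n + 1), ‖(1 - (∑ b ∈ Finset.range a, g b * v (n - b)) / N) ^ N‖ ≤
      K * r ^ (W.filter (· < a)).card := by
    intro a ha
    have hsub : Finset.range a ⊆ Finset.range (n + 1) :=
      Finset.range_subset_range.2 (Finset.mem_range.1 ha).le
    refine (hc_exp_full _ _ hN1 (hN2 a ha) _ (HC τ τ' hτ hτ' g v hg hv n _ hsub)).trans ?_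
    have : (Finset.range a).filter (fun a => 2 ^ a * τ ≤ β ∧ 2 ^ (n - a) * τ' ≤ β) = W.filter (· < a) := by
      ext b
      have := @hsub b
      simp only [W, Finset.mem_filter, Finset.mem_range] at this ⊢
      tauto
    rw [this, hr', ← Real.exp_nat_mul, hK, ← Real.exp_add]
    apply Real.exp_le_exp.2
    linarith
  have hF2 : ∀ a ∈ Finset.range (n + 1), ‖(1 - (∑ b ∈ Finset.range a, g b * v (n - b)) / N) ^ N‖ ≤ K := by
    intro a ha
    refine (hF a ha).trans (mul_le_of_le_one_right (by positivity) (pow_le_one₀ (by positivity) hr.le))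
  set Fa := fun a => ‖(1 - (∑ b ∈ Finset.range a, g b * v (n - b)) / N) ^ N‖ with hFa
  have hFa0 : ∀ a, 0 ≤ Fa a := fun a => norm_nonneg _
  change (∑ a ∈ Finset.range (n + 1), ‖g a‖ * u (n - a) * Fa a ≤ _) ∧
    (∑ a ∈ Finset.range (n + 1), ‖g a‖ * u (n - a) * Fa a) * _ ≤ _
  change ∀ a ∈ Finset.range (n + 1), Fa a ≤ _ at hF
  change ∀ a ∈ Finset.range (n + 1), Fa a ≤ _ at hF2
  constructor
  · have : ∑ a ∈ Finset.range (n + 1), ‖g a‖ * u (n - a) * Fa a ≤ U * K * (1 - r)⁻¹ + B * K := by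
      rw [← Finset.sum_filter_add_sum_filter_not _ (fun a => 2 ^ a * τ ≤ β ∧ 2 ^ (n - a) * τ' ≤ β)]
      refine add_le_add ?_ ?_
      · calc _ ≤ ∑ a ∈ W, U * K * r ^ (W.filter (· < a)).card := by
              refine Finset.sum_le_sum fun a ha => ?_
              have := hF a (Finset.mem_filter.1 ha).1
              calc ‖g a‖ * u (n - a) * Fa a ≤ (1 * U) * (K * r ^ (W.filter (· < a)).card) :=
                    mul_le_mul (mul_le_mul (hg.1 a) (hu1 _) (hu0 _) zero_le_one) this (hFa0 a) (by positivity)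
                _ = _ := by ring
          _ ≤ _ := by
              rw [← Finset.mul_sum]
              exact mul_le_mul_of_nonneg_left (hc_geom_rank _ _ (by positivity) hr) (by positivity)
      · calc _ ≤ ∑ a ∈ (Finset.range (n + 1)).filter (fun a => ¬ (2 ^ a * τ ≤ β ∧ 2 ^ (n - a) * τ' ≤ β)),
                ‖g a‖ * u (n - a) * K := by
              refine Finset.sum_le_sum fun a ha => ?_
              exact mul_le_mul_of_nonneg_left (hF2 a (Finset.mem_filter.1 ha).1) (mul_nonneg (norm_nonneg _) (hu0 _))
          _ ≤ _ := by
              rw [← Finset.sum_mul]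
              exact mul_le_mul_of_nonneg_right (HB τ τ' hτ hτ' (fun a => ‖g a‖) u (fun _ => norm_nonneg _)
                hg.1 hg.2.1 hu0 hu1 hu2 n) (by positivity)
    have : 0 ≤ U * D * K := by positivity
    linarith
  · have : (∑ a ∈ Finset.range (n + 1), ‖g a‖ * u (n - a) * Fa a) * (2 ^ n * (τ * τ')) ^ δ ≤ U * D * K := by
      calc _ ≤ ∑ a ∈ Finset.range (n + 1), U * K * (‖g a‖ * (2 ^ a * τ) ^ δ) := by
            rw [Finset.sum_mul]
            refine Finset.sum_le_sum fun a ha => ?_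
            rw [hc_pow_split τ τ' δ hτ hτ' n a (Nat.lt_succ_iff.1 (Finset.mem_range.1 ha))]
            calc _ = (u (n - a) * (2 ^ (n - a) * τ') ^ δ) * Fa a * (‖g a‖ * (2 ^ a * τ) ^ δ) := by ring
              _ ≤ _ := by
                gcongr
                · exact hu2 _
                · exact hF2 a ha
        _ = U * K * ∑ a ∈ Finset.range (n + 1), (‖g a‖ * (2 ^ a * τ) ^ δ) := by rw [Finset.mul_sum]
        _ ≤ U * K * D := by
            gcongr
            exact HD τ hτ (fun a => ‖g a‖) (fun _ => norm_nonneg _) hg.1 hg.2.1 n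
        _ = _ := by ring
    have : 0 ≤ U * K * (1 - r)⁻¹ + B * K := by positivity
    linarith
end HcPart2

section HcPart3
/-- Dyadic block of nonnegative integers. -/
noncomputable def hcBlock (a : ℕ) : Finset ℕ := (Finset.range (2 ^ a)).filter (fun i => Nat.size i = a)

theorem hc_mem_block {i a : ℕ} : i ∈ hcBlock a ↔ Nat.size i = a := by
  unfold hcBlock
  rw [Finset.mem_filter, Finset.mem_range, and_iff_right_iff_imp]
  intro h
  exact Nat.size_le.1 h.le

theorem hc_block_zero : hcBlock 0 = {0} := by
  ext i; rw [hc_mem_block, Nat.size_eq_zero, Finset.mem_singleton]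

theorem hc_block_succ (a : ℕ) : hcBlock (a + 1) = Finset.Ico (2 ^ a) (2 ^ (a + 1)) := by
  ext i
  rw [hc_mem_block, Finset.mem_Ico, ← Nat.lt_size, ← Nat.size_le]
  omega

theorem hc_block_card_pos (a : ℕ) : 0 < (hcBlock a).card := by
  cases a with
  | zero => simp [hc_block_zero]
  | succ a => rw [hc_block_succ, Nat.card_Ico, pow_succ]; have := Nat.two_pow_pos a; omega

theorem hc_block_card_le (a : ℕ) : (hcBlock a).card ≤ 2 ^ a := by
  cases a with
  | zero => simp [hc_block_zero]
  | succ a => rw [hc_block_succ, Nat.card_Ico]; exact Nat.sub_le _ _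

theorem hc_block_card_ge (a : ℕ) : 2 ^ a ≤ 2 * (hcBlock a).card := by
  cases a with
  | zero => simp [hc_block_zero]
  | succ a => rw [hc_block_succ, Nat.card_Ico, pow_succ]; omega

theorem hc_block_sum_mul (z : ℂ) (hz : ‖z‖ = 1) (a : ℕ) : ‖∑ i ∈ hcBlock a, z ^ i‖ * ‖z - 1‖ ≤ 2 := by
  have h2 : ∀ w : ℂ, ‖w‖ = 1 → ∀ w' : ℂ, ‖w'‖ = 1 → ‖w - w'‖ ≤ 2 := by
    intro w hw w' hw'
    refine (norm_sub_le _ _).trans ?_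
    rw [hw, hw']; norm_num
  cases a with
  | zero => simpa [hc_block_zero] using h2 z hz 1 (by simp)
  | succ a =>
    rw [hc_block_succ, ← norm_mul, geom_sum_Ico_mul _ (Nat.pow_le_pow_right (by norm_num) (Nat.le_succ a))]
    exact h2 _ (by simp [hz]) _ (by simp [hz])

theorem hc_pow_sub_one (z : ℂ) (hz : ‖z‖ = 1) (i : ℕ) : ‖1 - z ^ i‖ ≤ i * ‖z - 1‖ := by
  rw [← mul_neg_geom_sum, norm_mul, mul_comm, norm_sub_rev]
  gcongr
  refine (norm_sum_le _ _).trans ?_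
  simp [hz]

theorem hc_G_bounds (z : ℂ) (hz : ‖z‖ = 1) :
    HcG (‖z - 1‖ / 2) (fun a => ((hcBlock a).card : ℂ)⁻¹ * ∑ i ∈ hcBlock a, z ^ i) := by
  have hc : ∀ a, (0 : ℝ) < (hcBlock a).card := fun a => by exact_mod_cast hc_block_card_pos a
  refine ⟨fun a => ?_, fun a => ?_, fun a => ?_⟩
  · rw [norm_mul, norm_inv, Complex.norm_natCast, inv_mul_le_iff₀ (hc a), mul_one]
    refine (norm_sum_le _ _).trans ?_
    simp [hz]
  · rw [norm_mul, norm_inv, Complex.norm_natCast]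
    have h1 := hc_block_sum_mul z hz a
    have h2 : (2 : ℝ) ^ a ≤ 2 * (hcBlock a).card := by exact_mod_cast hc_block_card_ge a
    calc _ = (((hcBlock a).card : ℝ)⁻¹ * 2 ^ a / 2) * (‖∑ i ∈ hcBlock a, z ^ i‖ * ‖z - 1‖) := by ring
      _ ≤ (((hcBlock a).card : ℝ)⁻¹ * (2 * (hcBlock a).card) / 2) * 2 := by gcongr
      _ = 2 := by have := hc a; field_simp
  · have e : 1 - ((hcBlock a).card : ℂ)⁻¹ * ∑ i ∈ hcBlock a, z ^ i =
        ((hcBlock a).card : ℂ)⁻¹ * ∑ i ∈ hcBlock a, (1 - z ^ i) := by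
      have : ((hcBlock a).card : ℂ) ≠ 0 := by exact_mod_cast (hc a).ne'
      rw [Finset.sum_sub_distrib]; simp; field_simp
    rw [e, norm_mul, norm_inv, Complex.norm_natCast, inv_mul_le_iff₀ (hc a)]
    refine (norm_sum_le _ _).trans ?_
    rw [← nsmul_eq_mul]
    refine Finset.sum_le_card_nsmul _ _ _ fun i hi => (hc_pow_sub_one z hz i).trans ?_
    have : (i : ℝ) ≤ 2 ^ a := by
      exact_mod_cast (Nat.size_le.1 (hc_mem_block.1 hi).le).le
    calc (i : ℝ) * ‖z - 1‖ ≤ 2 ^ a * ‖z - 1‖ := by gcongr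
      _ = _ := by ring

theorem hc_phi_bound (z : ℂ) (e a : ℕ) (he : e ≤ 1) :
    ‖∑ i ∈ (hcBlock a).filter (e ≤ ·), z ^ i‖ ≤ 2 ^ a * ‖((hcBlock a).card : ℂ)⁻¹ * ∑ i ∈ hcBlock a, z ^ i‖ := by
  have hc : (0 : ℝ) < (hcBlock a).card := by exact_mod_cast hc_block_card_pos a
  have h1 : ‖∑ i ∈ (hcBlock a).filter (e ≤ ·), z ^ i‖ ≤ ‖∑ i ∈ hcBlock a, z ^ i‖ := by
    cases a with
    | zero =>
      rw [hc_block_zero, Finset.filter_singleton]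
      split_ifs
      · exact le_rfl
      · simp
    | succ a =>
      rw [Finset.filter_true_of_mem]
      intro i hi
      rw [hc_block_succ, Finset.mem_Ico] at hi
      have := Nat.two_pow_pos a; omega
  refine h1.trans ?_
  rw [norm_mul, norm_inv, Complex.norm_natCast, ← mul_assoc]
  refine le_mul_of_one_le_left (norm_nonneg _) ?_
  rw [← div_eq_mul_inv, one_le_div hc]
  exact_mod_cast hc_block_card_le a

open MvPolynomial
open scoped Pointwise

/-- Exponents supported in `J` whose dyadic weight over `K` is at least `k`. -/
def hcUp {d : ℕ} (J K : Finset (Fin d)) (k : ℕ) : Set (Fin d →₀ ℕ) :=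
  {m | (∀ j, j ∉ J → m j = 0) ∧ k ≤ ∑ j ∈ K, Nat.size (m j)}

/-- Polynomials with exponents in `hcUp`. -/
noncomputable def hcI {d : ℕ} (J K : Finset (Fin d)) (k : ℕ) : Submodule ℂ (MvPolynomial (Fin d) ℂ) :=
  restrictSupport ℂ (hcUp J K k)

theorem hcI_mono {d : ℕ} {J J' K K' : Finset (Fin d)} {k k' : ℕ} (hJ : J ⊆ J') (hK : K ⊆ K') (hk : k' ≤ k) :
    hcI J K k ≤ hcI J' K' k' := by
  refine restrictSupport_mono _ ?_
  rintro m ⟨h1, h2⟩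
  exact ⟨fun j hj => h1 j (fun h => hj (hJ h)), hk.trans (h2.trans (Finset.sum_le_sum_of_subset hK))⟩

theorem hcI_mul {d : ℕ} {J J' K K' : Finset (Fin d)} {k k' : ℕ} (h : Disjoint K K')
    {p q : MvPolynomial (Fin d) ℂ} (hp : p ∈ hcI J K k) (hq : q ∈ hcI J' K' k') :
    p * q ∈ hcI (J ∪ J') (K ∪ K') (k + k') := by
  have h1 : p * q ∈ restrictSupport ℂ (hcUp J K k + hcUp J' K' k') := by
    rw [restrictSupport_add]; exact Submodule.mul_mem_mul hp hq
  refine restrictSupport_mono _ ?_ h1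
  rintro _ ⟨m, ⟨hm1, hm2⟩, m', ⟨hm1', hm2'⟩, rfl⟩
  refine ⟨fun j hj => ?_, ?_⟩
  · rw [Finset.notMem_union] at hj
    simp [hm1 j hj.1, hm1' j hj.2]
  · rw [Finset.sum_union h]
    refine add_le_add (hm2.trans (Finset.sum_le_sum fun j _ => Nat.size_le_size ?_))
      (hm2'.trans (Finset.sum_le_sum fun j _ => Nat.size_le_size ?_)) <;> simp

theorem hcI_mul_self {d : ℕ} {J K : Finset (Fin d)} {k : ℕ}
    {p q : MvPolynomial (Fin d) ℂ} (hp : p ∈ hcI J K k) (hq : q ∈ hcI J ∅ 0) :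
    p * q ∈ hcI J K k := by
  have := hcI_mul (Finset.disjoint_empty_right K) hp hq
  simpa using this

theorem hcI_one {d : ℕ} (J K : Finset (Fin d)) : (1 : MvPolynomial (Fin d) ℂ) ∈ hcI J K 0 := by
  rw [← C_1, C_apply]
  exact (monomial_mem_restrictSupport _).2 (Or.inl ⟨fun _ _ => rfl, Nat.zero_le _⟩)

theorem hcI_zero_of {d : ℕ} {J K : Finset (Fin d)} {k : ℕ} {q : MvPolynomial (Fin d) ℂ}
    (hq : q ∈ hcI J K k) : q ∈ hcI J ∅ 0 := by
  refine restrictSupport_mono _ ?_ hq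
  rintro m ⟨h1, h2⟩
  exact ⟨h1, Nat.zero_le _⟩

theorem hcI_one_sub_mul {d : ℕ} {J K : Finset (Fin d)} {k : ℕ}
    {p q : MvPolynomial (Fin d) ℂ} (hp : 1 - p ∈ hcI J K k) (hq : 1 - q ∈ hcI J K k) :
    1 - p * q ∈ hcI J K k := by
  have e : 1 - p * q = (1 - p) + (1 - q) - (1 - p) * (1 - q) := by ring
  rw [e]
  refine Submodule.sub_mem _ (Submodule.add_mem _ hp hq) (hcI_mul_self hp (hcI_zero_of hq))

theorem hcI_one_sub_pow {d : ℕ} {J K : Finset (Fin d)} {k : ℕ}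
    {p : MvPolynomial (Fin d) ℂ} (hp : 1 - p ∈ hcI J K k) (N : ℕ) :
    1 - p ^ N ∈ hcI J K k := by
  induction N with
  | zero => simp
  | succ N ih => rw [pow_succ]; exact hcI_one_sub_mul ih hp

/-- one-variable normalized block polynomial -/
noncomputable def hcGp {d : ℕ} (j : Fin d) (a : ℕ) : MvPolynomial (Fin d) ℂ :=
  C ((hcBlock a).card : ℂ)⁻¹ * ∑ i ∈ hcBlock a, X j ^ i

/-- one-variable block polynomial -/
noncomputable def hcPhi {d : ℕ} (j : Fin d) (e a : ℕ) : MvPolynomial (Fin d) ℂ :=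
  ∑ i ∈ (hcBlock a).filter (e ≤ ·), X j ^ i

theorem hcX_mem {d : ℕ} (j : Fin d) (i a : ℕ) (h : Nat.size i = a) :
    (X j ^ i : MvPolynomial (Fin d) ℂ) ∈ hcI {j} {j} a := by
  rw [X_pow_eq_monomial]
  refine (monomial_mem_restrictSupport _).2 (Or.inl ⟨fun l hl => ?_, ?_⟩)
  · rw [Finset.mem_singleton] at hl
    exact Finsupp.single_eq_of_ne hl
  · simp [h]

theorem hcGp_mem {d : ℕ} (j : Fin d) (a : ℕ) : hcGp j a ∈ hcI {j} {j} a := by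
  unfold hcGp
  rw [C_mul']
  exact Submodule.smul_mem _ _ (Submodule.sum_mem _ fun i hi => hcX_mem j i a (hc_mem_block.1 hi))

theorem hcPhi_mem {d : ℕ} (j : Fin d) (e a : ℕ) : hcPhi j e a ∈ hcI {j} {j} a :=
  Submodule.sum_mem _ fun i hi => hcX_mem j i a (hc_mem_block.1 (Finset.mem_filter.1 hi).1)

theorem hcGp_eval {d : ℕ} (j : Fin d) (z : Fin d → ℂ) (hz : ‖z j‖ = 1) :
    HcG (‖z j - 1‖ / 2) (fun a => eval z (hcGp j a)) := by
  have := hc_G_bounds (z j) hz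
  simpa [hcGp] using this

theorem hcPhi_eval {d : ℕ} (j : Fin d) (z : Fin d → ℂ) (e a : ℕ) (he : e ≤ 1) :
    ‖eval z (hcPhi j e a)‖ ≤ 2 ^ a * ‖eval z (hcGp j a)‖ := by
  have := hc_phi_bound (z j) e a he
  simpa [hcGp, hcPhi] using this

theorem hc_tau_le_one {d : ℕ} (J : Finset (Fin d)) (z : Fin d → ℂ) (hz : ∀ j, ‖z j‖ = 1) :
    ∏ j ∈ J, ‖z j - 1‖ / 2 ≤ 1 := by
  refine Finset.prod_le_one (fun _ _ => by positivity) fun j _ => ?_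
  have := norm_sub_le (z j) 1
  rw [hz j, norm_one] at this
  linarith

theorem hc_helper {d : ℕ} (J : Finset (Fin d)) : ∃ A : ℝ, 1 ≤ A ∧ ∃ v : ℕ → MvPolynomial (Fin d) ℂ,
    (∀ m, v m ∈ hcI J J m) ∧ ∀ z : Fin d → ℂ, (∀ j, ‖z j‖ = 1) →
      HcV A (1 / 2) (∏ j ∈ J, ‖z j - 1‖ / 2) (fun m => eval z (v m)) := by
  induction J using Finset.induction_on with
  | empty =>
    refine ⟨1, le_rfl, fun m => if m = 0 then 1 else 0, ?_, ?_⟩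
    · intro m
      dsimp only
      split_ifs with h
      · rw [h]; exact hcI_one _ _
      · exact Submodule.zero_mem _
    · intro z _
      rw [Finset.prod_empty]
      refine ⟨fun m => ?_, fun m => ?_, fun m => ?_⟩
      · dsimp only; split_ifs <;> simp
      · dsimp only; split_ifs with h
        · simp [h]
        · simp
      · dsimp only; split_ifs with h
        · simp [h]
        · simp only [map_zero, sub_zero, norm_one, one_mul, mul_one]
          exact Real.one_le_rpow (one_le_pow₀ (by norm_num)) (by norm_num)
  | insert j J hj ih =>
    obtain ⟨A, hA, v, hv, hvb⟩ := ih
    obtain ⟨A', hA', H⟩ := hc_helper_step A (1 / 2) hA (by norm_num) le_rfl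
    set N : ℕ → ℕ := fun m => ⌈(((m : ℝ) + 1) * A) ^ 2⌉₊ + 1 with hN
    refine ⟨A', hA', fun m => 1 - (1 - v m) * (1 - hcGp j m) *
      (1 - C ((N m : ℂ)⁻¹) * ∑ a ∈ Finset.range (m + 1), hcGp j a * v (m - a)) ^ N m, ?_, ?_⟩
    · intro m
      have s1 : J ⊆ insert j J := Finset.subset_insert _ _
      have s2 : {j} ⊆ insert j J := by simp
      refine hcI_one_sub_mul (hcI_one_sub_mul ?_ ?_) (hcI_one_sub_pow ?_ _)
      · rw [sub_sub_cancel]; exact hcI_mono s1 s1 le_rfl (hv m)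
      · rw [sub_sub_cancel]; exact hcI_mono s2 s2 le_rfl (hcGp_mem j m)
      · rw [sub_sub_cancel, C_mul']
        refine Submodule.smul_mem _ _ (Submodule.sum_mem _ fun a ha => ?_)
        have := hcI_mul (Finset.disjoint_singleton_left.2 hj) (hcGp_mem j a) (hv (m - a))
        refine hcI_mono (by rw [Finset.insert_eq]) (by rw [Finset.insert_eq]) ?_ this
        omega
    · intro z hz
      rw [Finset.prod_insert hj]
      have hG := hcGp_eval j z (hz j)
      have h1 : ∀ m, ‖∑ a ∈ Finset.range (m + 1), eval z (hcGp j a) * eval z (v (m - a))‖ ^ 2 ≤ (N m : ℝ) := by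
        intro m
        have : ‖∑ a ∈ Finset.range (m + 1), eval z (hcGp j a) * eval z (v (m - a))‖ ≤ ((m : ℝ) + 1) * A := by
          refine (norm_sum_le_of_le _ (n := fun _ => A) fun a _ => ?_).trans (by simp)
          rw [norm_mul]
          have := mul_le_mul (hG.1 a) ((hvb z hz).1 (m - a)) (norm_nonneg _) zero_le_one
          rwa [one_mul] at this
        calc _ ≤ (((m : ℝ) + 1) * A) ^ 2 := by gcongr
          _ ≤ _ := by
            simp only [hN]; push_cast
            exact (Nat.le_ceil _).trans (by linarith)
      have := H (‖z j - 1‖ / 2) _ (by positivity) (by simpa using hc_tau_le_one {j} z hz)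
        (Finset.prod_nonneg fun _ _ => by positivity)
        (hc_tau_le_one J z hz) _ _ hG (hvb z hz) N (fun m => by simp only [hN]; omega) h1
      convert this using 2 with m
      simp [div_eq_inv_mul, mul_comm]
end HcPart3

section HcPart4
open MvPolynomial
open scoped Pointwise

theorem hcI_coeff_zero {d : ℕ} {J K : Finset (Fin d)} {k : ℕ} {p : MvPolynomial (Fin d) ℂ}
    (hp : p ∈ hcI J K k) (m : Fin d →₀ ℕ) (hm : m ∉ hcUp J K k) : coeff m p = 0 := by
  by_contra h
  exact hm (((mem_restrictSupport_iff ℂ).1 hp) (mem_support_iff.2 h))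

theorem hc_coeff_X_mul {d : ℕ} {J : Finset (Fin d)} {j : Fin d} (hj : j ∉ J) {p : MvPolynomial (Fin d) ℂ}
    (hp : p ∈ hcI J ∅ 0) (m : Fin d →₀ ℕ) (i : ℕ) :
    coeff m (X j ^ i * p) = if i = m j then coeff (m.erase j) p else 0 := by
  rw [X_pow_eq_monomial, coeff_monomial_mul']
  split_ifs with h1 h2 h2
  · rw [one_mul]
    congr 1
    rw [h2]
    ext l
    rcases eq_or_ne l j with rfl | hl
    · simp
    · simp [Finsupp.single_eq_of_ne hl, Finsupp.erase_ne hl]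
  · rw [one_mul]
    refine hcI_coeff_zero hp _ fun h => h2 ?_
    have := h.1 j hj
    have h3 : i ≤ m j := by simpa using h1 j
    simp at this
    omega
  · exact absurd (by rw [h2]; exact (Finsupp.single_le_iff.2 le_rfl)) h1
  · rfl

theorem hc_coeff_phi_mul {d : ℕ} {J : Finset (Fin d)} {j : Fin d} (hj : j ∉ J) {p : MvPolynomial (Fin d) ℂ}
    (hp : p ∈ hcI J ∅ 0) (m : Fin d →₀ ℕ) (e a : ℕ) :
    coeff m (hcPhi j e a * p) = if Nat.size (m j) = a ∧ e ≤ m j then coeff (m.erase j) p else 0 := by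
  unfold hcPhi
  rw [Finset.sum_mul, coeff_sum]
  simp only [hc_coeff_X_mul hj hp]
  rw [Finset.sum_ite_eq' ]
  simp only [Finset.mem_filter, hc_mem_block]

theorem hc_kernel {d : ℕ} (J : Finset (Fin d)) (δ : ℝ) (hδ : 0 < δ) (hδ1 : δ < 1) (e : Fin d → ℕ)
    (he : ∀ j, e j ≤ 1) :
    ∃ U : ℝ, 0 ≤ U ∧ ∃ V : ℕ → MvPolynomial (Fin d) ℂ, (∀ n, V n ∈ hcI J ∅ 0) ∧
      (∀ n (m : Fin d →₀ ℕ), (∀ j, j ∉ J → m j = 0) → ∑ j ∈ J, Nat.size (m j) ≤ n →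
        coeff m (V n) = if ∀ j ∈ J, e j ≤ m j then 1 else 0) ∧
      ∀ z : Fin d → ℂ, (∀ j, ‖z j‖ = 1) → ∀ n, ‖eval z (V n)‖ ≤ U * 2 ^ n ∧
        ‖eval z (V n)‖ * (2 ^ n * ∏ j ∈ J, ‖z j - 1‖ / 2) ^ δ ≤ U * 2 ^ n := by
  induction J using Finset.induction_on with
  | empty =>
    refine ⟨1, zero_le_one, fun _ => 1, fun _ => hcI_one _ _, ?_, ?_⟩
    · intro n m hm _
      have : m = 0 := by ext j; simpa using hm j (by simp)
      rw [this]; simp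
    · intro z _ n
      simp only [map_one, norm_one, one_mul, Finset.prod_empty, mul_one]
      have h1 : (1 : ℝ) ≤ 2 ^ n := one_le_pow₀ (by norm_num)
      refine ⟨h1, ?_⟩
      calc ((2 : ℝ) ^ n) ^ δ ≤ ((2 : ℝ) ^ n) ^ (1 : ℝ) := Real.rpow_le_rpow_of_exponent_le h1 hδ1.le
        _ = _ := Real.rpow_one _
  | insert j J hj ih =>
    obtain ⟨U, hU, V, hV, hVc, hVb⟩ := ih
    obtain ⟨A, hA, v, hv, hvb⟩ := hc_helper J
    obtain ⟨U', hU', H⟩ := hc_kernel_step A (1 / 2) U δ hA (by norm_num) hU hδ hδ1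
    set N : ℕ → ℕ := fun m => ⌈(((m : ℝ) + 1) * A) ^ 2⌉₊ + 1 with hN
    set F : ℕ → ℕ → MvPolynomial (Fin d) ℂ := fun n a =>
      (1 - C ((N n : ℂ)⁻¹) * ∑ b ∈ Finset.range a, hcGp j b * v (n - b)) ^ N n with hF
    have s1 : J ⊆ insert j J := Finset.subset_insert _ _
    have s2 : {j} ⊆ insert j J := by simp
    have hF1 : ∀ n a, a ∈ Finset.range (n + 1) → 1 - F n a ∈ hcI (insert j J) J (n - a + 1) := by
      intro n a ha
      refine hcI_one_sub_pow ?_ _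
      rw [sub_sub_cancel, C_mul']
      refine Submodule.smul_mem _ _ (Submodule.sum_mem _ fun b hb => ?_)
      have h1 := hcI_mul (Finset.disjoint_empty_left _) (hcI_zero_of (hcGp_mem j b)) (hv (n - b))
      rw [Finset.mem_range] at ha hb
      refine hcI_mono (by rw [Finset.insert_eq]) (by simp) ?_ h1
      omega
    have hF0 : ∀ n a, a ∈ Finset.range (n + 1) → F n a ∈ hcI (insert j J) ∅ 0 := by
      intro n a ha
      have := Submodule.sub_mem _ (hcI_one (insert j J) ∅) (hcI_zero_of (hF1 n a ha))
      rwa [sub_sub_cancel] at this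
    have hP0 : ∀ n a, hcPhi j (e j) a * V (n - a) ∈ hcI (insert j J) {j} a := by
      intro n a
      have := hcI_mul (Finset.disjoint_empty_right _) (hcPhi_mem j (e j) a) (hV (n - a))
      exact hcI_mono (by rw [Finset.insert_eq]) (by simp) le_rfl this
    refine ⟨U', hU', fun n => ∑ a ∈ Finset.range (n + 1), hcPhi j (e j) a * V (n - a) * F n a, ?_, ?_, ?_⟩
    · intro n
      refine Submodule.sum_mem _ fun a ha => hcI_mul_self (hcI_zero_of (hP0 n a)) (hF0 n a ha)
    · intro n m hm hw
      rw [Finset.sum_insert hj] at hw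
      have h1 : ∀ a ∈ Finset.range (n + 1), coeff m (hcPhi j (e j) a * V (n - a) * F n a) =
          if Nat.size (m j) = a ∧ e j ≤ m j then coeff (m.erase j) (V (n - a)) else 0 := by
        intro a ha
        have e1 : hcPhi j (e j) a * V (n - a) * F n a = hcPhi j (e j) a * V (n - a) -
          hcPhi j (e j) a * V (n - a) * (1 - F n a) := by ring
        have h2 := hcI_mul (Finset.disjoint_singleton_left.2 hj) (hP0 n a) (hF1 n a ha)
        rw [e1, coeff_sub, hcI_coeff_zero h2 m, sub_zero, hc_coeff_phi_mul hj (hV _)]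
        rintro ⟨-, h3⟩
        rw [Finset.sum_union (Finset.disjoint_singleton_left.2 hj), Finset.sum_singleton] at h3
        rw [Finset.mem_range] at ha
        omega
      rw [coeff_sum, Finset.sum_congr rfl h1]
      rw [Finset.sum_eq_single (Nat.size (m j))]
      · have h2 : coeff (m.erase j) (V (n - Nat.size (m j))) = if ∀ l ∈ J, e l ≤ m l then 1 else 0 := by
          have hne : ∀ l ∈ J, (m.erase j) l = m l := fun l hl =>
            Finsupp.erase_ne (fun h => hj (h ▸ hl))
          rw [hVc]
          · have : (∀ l ∈ J, e l ≤ (m.erase j) l) ↔ ∀ l ∈ J, e l ≤ m l :=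
              forall₂_congr fun l hl => by rw [hne l hl]
            simp only [this]
          · intro l hl
            rcases eq_or_ne l j with rfl | hlj
            · simp
            · rw [Finsupp.erase_ne hlj]; exact hm l (by simp [hlj, hl])
          · rw [Finset.sum_congr rfl fun l hl => by rw [hne l hl]]
            omega
        simp only [true_and, h2, Finset.forall_mem_insert]
        split_ifs <;> first | rfl | (exfalso; tauto)
      · intro a _ ha
        rw [if_neg]; rintro ⟨h, -⟩; exact ha h.symm
      · intro h; exfalso; apply h; rw [Finset.mem_range]; omega
    · intro z hz n
      rw [Finset.prod_insert hj]
      have hG := hcGp_eval j z (hz j)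
      have h1 : ∀ a ∈ Finset.range (n + 1), ‖∑ b ∈ Finset.range a, eval z (hcGp j b) * eval z (v (n - b))‖ ^ 2 ≤ (N n : ℝ) := by
        intro a ha
        have : ‖∑ b ∈ Finset.range a, eval z (hcGp j b) * eval z (v (n - b))‖ ≤ ((n : ℝ) + 1) * A := by
          refine (norm_sum_le_of_le _ (n := fun _ => A) fun b _ => ?_).trans ?_
          · rw [norm_mul]
            have := mul_le_mul (hG.1 b) ((hvb z hz).1 (n - b)) (norm_nonneg _) zero_le_one
            rwa [one_mul] at this
          · rw [Finset.sum_const, Finset.card_range, nsmul_eq_mul]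
            gcongr
            have := (Finset.mem_range.1 ha).le
            exact_mod_cast this
        calc _ ≤ (((n : ℝ) + 1) * A) ^ 2 := by gcongr
          _ ≤ _ := by
            simp only [hN]; push_cast
            exact (Nat.le_ceil _).trans (by linarith)
      have h2 := H (‖z j - 1‖ / 2) _ (by positivity)
        (Finset.prod_nonneg fun _ _ => by positivity)
        _ _ hG (hvb z hz) (fun k => ‖eval z (V k)‖ / 2 ^ k) (fun _ => by positivity)
        (fun k => by rw [div_le_iff₀ (by positivity)]; exact (hVb z hz k).1)
        (fun k => by rw [div_mul_eq_mul_div, div_le_iff₀ (by positivity)]; exact (hVb z hz k).2)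
        n (N n) (by simp only [hN]; omega) h1
      have h3 : ‖eval z (∑ a ∈ Finset.range (n + 1), hcPhi j (e j) a * V (n - a) * F n a)‖ ≤
          2 ^ n * ∑ a ∈ Finset.range (n + 1), ‖eval z (hcGp j a)‖ * (‖eval z (V (n - a))‖ / 2 ^ (n - a)) *
            ‖(1 - (∑ b ∈ Finset.range a, eval z (hcGp j b) * eval z (v (n - b))) / N n) ^ N n‖ := by
        rw [map_sum, Finset.mul_sum]
        refine norm_sum_le_of_le _ fun a ha => ?_
        rw [map_mul, map_mul, norm_mul, norm_mul]
        have e1 : eval z (F n a) = (1 - (∑ b ∈ Finset.range a, eval z (hcGp j b) * eval z (v (n - b))) / N n) ^ N n := by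
          simp [hF, div_eq_inv_mul]
        rw [e1, ← mul_assoc]
        refine mul_le_mul_of_nonneg_right ?_ (norm_nonneg _)
        have e2 : (2 : ℝ) ^ n = 2 ^ a * 2 ^ (n - a) := by
          rw [← pow_add, Nat.add_sub_cancel' (Nat.lt_succ_iff.1 (Finset.mem_range.1 ha))]
        calc _ ≤ (2 ^ a * ‖eval z (hcGp j a)‖) * ‖eval z (V (n - a))‖ := by
              gcongr; exact hcPhi_eval j z (e j) a (he j)
          _ = _ := by rw [e2]; field_simp
      constructor
      · refine h3.trans ?_
        rw [mul_comm]; gcongr; exact h2.1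
      · refine (mul_le_mul_of_nonneg_right h3 (by positivity)).trans ?_
        rw [mul_assoc, mul_comm]; gcongr; exact h2.2
end HcPart4

section HcPart5
theorem hc_cell_meas (d : ℕ) : MeasurableSet (torusCell d) :=
  MeasurableSet.univ_pi fun _ => measurableSet_Ico

theorem hc_integral_prod (d : ℕ) (𝕜 : Type) [RCLike 𝕜] (F : Fin d → ℝ → 𝕜) :
    ∫ y, ∏ j, F j (y j) ∂(torusMeasure d) =
      ∏ j, ((((2 * Real.pi)⁻¹ : ℝ) : 𝕜) * ∫ u in Set.Ico 0 (2 * Real.pi), F j u) := by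
  unfold torusMeasure torusCell
  rw [integral_smul_measure, volume_pi, Measure.restrict_pi_pi, integral_fintype_prod_eq_prod,
    Finset.prod_mul_distrib, ENNReal.toReal_inv, ENNReal.toReal_ofReal (by positivity)]
  rw [Finset.prod_const, Finset.card_univ, Fintype.card_fin, RCLike.real_smul_eq_coe_mul]
  push_cast
  rw [inv_pow]

theorem hc_ae_cell (d : ℕ) : ∀ᵐ y ∂(torusMeasure d), y ∈ torusCell d := by
  unfold torusMeasure
  refine Measure.ae_smul_measure ?_ _
  exact ae_restrict_mem (hc_cell_meas d)

theorem hc_finite (d : ℕ) : IsFiniteMeasure (torusMeasure d) := by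
  have h1 : (volume : Measure (Fin d → ℝ)) (torusCell d) ≠ ⊤ := by
    unfold torusCell
    rw [Real.volume_pi_Ico]
    exact ENNReal.prod_ne_top fun _ _ => ENNReal.ofReal_ne_top
  refine ⟨?_⟩
  unfold torusMeasure
  rw [Measure.smul_apply, Measure.restrict_apply_univ, smul_eq_mul]
  refine (ENNReal.mul_ne_top ?_ h1).lt_top
  rw [ENNReal.inv_ne_top]
  exact (ENNReal.ofReal_pos.2 (by positivity)).ne'

theorem hc_memLp (d : ℕ) {E : Type} [NormedAddCommGroup E] [SecondCountableTopology E]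
    (g : (Fin d → ℝ) → E) (hg : Continuous g)
    (p : ENNReal) : MemLp g p (torusMeasure d) := by
  have := hc_finite d
  obtain ⟨C, hC⟩ := (isCompact_Icc (a := (0 : Fin d → ℝ)) (b := fun _ => 2 * Real.pi)).exists_bound_of_continuousOn
    hg.continuousOn
  refine MemLp.of_bound hg.aestronglyMeasurable C ?_
  filter_upwards [hc_ae_cell d] with y hy
  refine hC y ⟨fun j => (hy j (Set.mem_univ j)).1, fun j => (hy j (Set.mem_univ j)).2.le⟩

theorem hc_integrable (d : ℕ) {E : Type} [NormedAddCommGroup E] [SecondCountableTopology E]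
    (g : (Fin d → ℝ) → E) (hg : Continuous g) :
    Integrable g (torusMeasure d) := memLp_one_iff_integrable.1 (hc_memLp d g hg 1)

theorem hc_orth1 (l : ℤ) : (((2 * Real.pi)⁻¹ : ℝ) : ℂ) *
    ∫ u in Set.Ico 0 (2 * Real.pi), Complex.exp (Complex.I * ((l : ℂ) * (u : ℂ))) = if l = 0 then 1 else 0 := by
  rw [integral_Ico_eq_integral_Ioc, ← intervalIntegral.integral_of_le (by positivity)]
  split_ifs with h
  · have hpi : (Real.pi : ℂ) ≠ 0 := by exact_mod_cast Real.pi_ne_zero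
    simp [h]; field_simp
  · have hl : Complex.I * (l : ℂ) ≠ 0 := mul_ne_zero Complex.I_ne_zero (by exact_mod_cast h)
    simp only [← mul_assoc]
    rw [integral_exp_mul_complex hl]
    have : Complex.exp (Complex.I * l * ((2 * Real.pi : ℝ) : ℂ)) = 1 := by
      rw [Complex.exp_eq_one_iff]
      exact ⟨l, by push_cast; ring⟩
    rw [this]; simp

theorem hc_H_int (e : ℝ) (he : 1 < e) : ∃ C : ℝ, 0 ≤ C ∧ ∀ (r : ℕ) (x : ℝ),
    (2 * Real.pi)⁻¹ * ∫ u in Set.Ico 0 (2 * Real.pi), (max 1 ((2 : ℝ) ^ r * |Real.sin ((x - u) / 2)|)) ^ (-e)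
      ≤ C * (2 ^ r)⁻¹ := by
  have hint : Integrable (fun u : ℝ => (1 + ‖u‖) ^ (-e)) := integrable_one_add_norm (by simpa using he)
  refine ⟨(2 * Real.pi)⁻¹ * (2 ^ e * (Real.pi * ∫ u : ℝ, (1 + ‖u‖) ^ (-e))), ?_, ?_⟩
  · have : 0 ≤ ∫ u : ℝ, (1 + ‖u‖) ^ (-e) := integral_nonneg fun u => by positivity
    positivity
  intro r x
  set h : ℝ → ℝ := fun w => (max 1 ((2 : ℝ) ^ r * |Real.sin (w / 2)|)) ^ (-e) with hh
  have hcont : Continuous h := by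
    have : Continuous fun w : ℝ => max 1 ((2 : ℝ) ^ r * |Real.sin (w / 2)|) := by fun_prop
    exact this.rpow_const fun w => Or.inl (by positivity)
  have hper : Function.Periodic h (2 * Real.pi) := by
    intro w
    simp only [hh]
    have : (w + 2 * Real.pi) / 2 = w / 2 + Real.pi := by ring
    rw [this, Real.sin_add_pi, abs_neg]
  have h1 : ∫ u in Set.Ico 0 (2 * Real.pi), (max 1 ((2 : ℝ) ^ r * |Real.sin ((x - u) / 2)|)) ^ (-e) =
      ∫ w in (-Real.pi)..Real.pi, h w := by
    rw [integral_Ico_eq_integral_Ioc, ← intervalIntegral.integral_of_le (by positivity)]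
    change ∫ u in (0 : ℝ)..2 * Real.pi, h (x - u) = _
    rw [intervalIntegral.integral_comp_sub_left]
    have := hper.intervalIntegral_add_eq (x - 2 * Real.pi) (-Real.pi)
    rw [sub_add_cancel] at this
    rw [sub_zero, this]
    congr 1; ring
  rw [h1, mul_assoc]
  refine mul_le_mul_of_nonneg_left ?_ (by positivity)
  have hc : (0 : ℝ) < 2 ^ r / Real.pi := by positivity
  have hint2 : Integrable (fun u : ℝ => 2 ^ e * (1 + ‖(2 ^ r / Real.pi) * u‖) ^ (-e)) :=
    (hint.comp_mul_left' hc.ne').const_mul _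
  calc ∫ w in (-Real.pi)..Real.pi, h w
      ≤ ∫ w in (-Real.pi)..Real.pi, 2 ^ e * (1 + ‖(2 ^ r / Real.pi) * w‖) ^ (-e) := by
        refine intervalIntegral.integral_mono_on (by linarith [Real.pi_pos]) (hcont.intervalIntegrable _ _)
          (hint2.intervalIntegrable) fun w hw => ?_
        have hw' : |w| ≤ Real.pi := abs_le.2 hw
        have h2 : |w| / Real.pi ≤ |Real.sin (w / 2)| := by
          have := Real.mul_abs_le_abs_sin (x := w / 2) (by rw [abs_div, abs_two]; linarith)
          refine le_trans (le_of_eq ?_) this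
          rw [abs_div, abs_two]; field_simp
        have h3 : ‖(2 ^ r / Real.pi) * w‖ ≤ 2 ^ r * |Real.sin (w / 2)| := by
          rw [norm_mul, Real.norm_of_nonneg hc.le, Real.norm_eq_abs]
          calc _ = 2 ^ r * (|w| / Real.pi) := by ring
            _ ≤ _ := by gcongr
        have h4 : (1 + ‖(2 ^ r / Real.pi) * w‖) / 2 ≤ max 1 ((2 : ℝ) ^ r * |Real.sin (w / 2)|) := by
          have a1 := le_max_left 1 ((2 : ℝ) ^ r * |Real.sin (w / 2)|)
          have a2 := le_max_right 1 ((2 : ℝ) ^ r * |Real.sin (w / 2)|)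
          linarith
        calc h w ≤ ((1 + ‖(2 ^ r / Real.pi) * w‖) / 2) ^ (-e) :=
              Real.rpow_le_rpow_of_nonpos (by positivity) h4 (by linarith)
          _ = _ := by
              rw [Real.div_rpow (by positivity) (by norm_num), Real.rpow_neg (by norm_num : (0:ℝ) ≤ 2),
                div_inv_eq_mul, mul_comm]
    _ ≤ ∫ w, 2 ^ e * (1 + ‖(2 ^ r / Real.pi) * w‖) ^ (-e) := by
        rw [intervalIntegral.integral_of_le (by linarith [Real.pi_pos])]
        exact setIntegral_le_integral hint2 (Filter.Eventually.of_forall fun w => by positivity)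
    _ = _ := by
        rw [integral_const_mul, Measure.integral_comp_mul_left (fun u : ℝ => (1 + ‖u‖) ^ (-e)), abs_of_pos (by positivity),
          smul_eq_mul, inv_div]
        ring
end HcPart5

section HcPart6
open MvPolynomial

theorem hc_decomp {d : ℕ} (J : Finset (Fin d)) (hJ : J.Nonempty) (τ : Fin d → ℝ) (h0 : ∀ j, 0 ≤ τ j)
    (h1 : ∀ j, τ j ≤ 1) (n : ℕ) : ∃ s ∈ Finset.piAntidiag J n,
      ∏ j ∈ J, max 1 ((2 : ℝ) ^ (s j) * τ j) ≤ 2 ^ J.card * max 1 (2 ^ n * ∏ j ∈ J, τ j) := by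
  induction hJ using Finset.Nonempty.cons_induction generalizing n with
  | singleton j =>
    refine ⟨Pi.single j n, ?_, ?_⟩
    · rw [Finset.mem_piAntidiag]
      refine ⟨by simp, fun i hi => ?_⟩
      by_contra h
      rw [Finset.mem_singleton] at h
      exact hi (by simp [Pi.single_apply, h])
    · simp only [Finset.prod_singleton, Pi.single_eq_same, Finset.card_singleton]
      have : 0 ≤ max 1 ((2 : ℝ) ^ n * τ j) := by positivity
      linarith
  | cons j J hj hJ ih =>
    rw [Finset.cons_eq_insert, Finset.prod_insert hj, Finset.card_insert_of_notMem hj]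
    have hP0 : 0 ≤ ∏ i ∈ J, τ i := Finset.prod_nonneg fun i _ => h0 i
    -- choose the level of the new variable
    have key : ∃ a ≤ n, 2 ^ a * τ j ≤ 1 ∧ (a = n ∨ 1 ≤ 2 ^ (a + 1) * τ j) := by
      clear ih
      induction n with
      | zero => exact ⟨0, le_rfl, by simpa using h1 j, Or.inl rfl⟩
      | succ n ihn =>
        obtain ⟨a, ha, h2, h3⟩ := ihn
        rcases h3 with h3 | h3
        · rcases le_total (2 ^ (a + 1) * τ j) 1 with h | h
          · exact ⟨a + 1, by omega, h, Or.inl (by omega)⟩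
          · exact ⟨a, by omega, h2, Or.inr h⟩
        · exact ⟨a, by omega, h2, Or.inr h3⟩
    obtain ⟨a, ha, h2, h3⟩ := key
    obtain ⟨s, hs, hs2⟩ := ih (n - a)
    rw [Finset.mem_piAntidiag] at hs
    have hsj : s j = 0 := by
      by_contra h; exact hj (hs.2 j h)
    have hne : ∀ i ∈ J, Function.update s j a i = s i := fun i hi =>
      Function.update_of_ne (fun h : i = j => hj (h ▸ hi)) _ _
    refine ⟨Function.update s j a, ?_, ?_⟩
    · rw [Finset.mem_piAntidiag]
      refine ⟨?_, fun i hi => ?_⟩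
      · rw [Finset.sum_insert hj, Function.update_self, Finset.sum_congr rfl hne, hs.1]
        omega
      · rcases eq_or_ne i j with rfl | hij
        · simp
        · rw [Function.update_of_ne hij] at hi
          exact Finset.mem_insert_of_mem (hs.2 i hi)
    · rw [Finset.prod_insert hj, Function.update_self, max_eq_left h2, one_mul,
        Finset.prod_congr rfl (fun i hi => by rw [hne i hi])]
      rcases h3 with h3 | h3
      · subst h3
        refine hs2.trans ?_
        have : (2 : ℝ) ^ (a - a) * ∏ i ∈ J, τ i ≤ 1 := by
          simpa using Finset.prod_le_one (fun i _ => h0 i) (fun i _ => h1 i)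
        rw [max_eq_left this]
        have h4 := le_max_left 1 ((2 : ℝ) ^ a * (τ j * ∏ i ∈ J, τ i))
        rw [pow_succ]
        have h5 : (0 : ℝ) < 2 ^ J.card := by positivity
        nlinarith
      · refine hs2.trans ?_
        rw [pow_succ, mul_assoc]
        gcongr
        have h4 := le_max_left 1 ((2 : ℝ) ^ n * (τ j * ∏ i ∈ J, τ i))
        have h5 := le_max_right 1 ((2 : ℝ) ^ n * (τ j * ∏ i ∈ J, τ i))
        refine max_le (by linarith) ?_
        calc (2 : ℝ) ^ (n - a) * ∏ i ∈ J, τ i ≤ (2 ^ (n - a) * ∏ i ∈ J, τ i) * (2 ^ (a + 1) * τ j) :=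
              le_mul_of_one_le_right (by positivity) h3
          _ = 2 * (2 ^ (n - a + a) * (τ j * ∏ i ∈ J, τ i)) := by rw [pow_add, pow_succ]; ring
          _ = 2 * (2 ^ n * (τ j * ∏ i ∈ J, τ i)) := by rw [Nat.sub_add_cancel ha]
          _ ≤ _ := by linarith

theorem hc_card_antidiag {d : ℕ} (J : Finset (Fin d)) (hJ : J.Nonempty) (n : ℕ) :
    (Finset.piAntidiag J n).card ≤ (n + 1) ^ (J.card - 1) := by
  obtain ⟨j, hj⟩ := hJ
  calc (Finset.piAntidiag J n).card
      ≤ (Fintype.piFinset (fun i => if i ∈ J.erase j then Finset.range (n + 1) else {0})).card := by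
        refine Finset.card_le_card_of_injOn (fun s => Function.update s j 0) ?_ ?_
        · intro s hs
          rw [Finset.mem_coe, Finset.mem_piAntidiag] at hs
          rw [Finset.mem_coe, Fintype.mem_piFinset]
          intro i
          rcases eq_or_ne i j with rfl | hij
          · simp
          · dsimp only
            rw [Function.update_of_ne hij]
            split_ifs with h
            · rw [Finset.mem_range, Nat.lt_succ_iff, ← hs.1]
              exact Finset.single_le_sum (fun _ _ => Nat.zero_le _) (Finset.mem_of_mem_erase h)
            · rw [Finset.mem_singleton]
              by_contra h0
              exact h (Finset.mem_erase.2 ⟨hij, hs.2 i h0⟩)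
        · intro s hs s' hs' h
          rw [Finset.mem_coe, Finset.mem_piAntidiag] at hs hs'
          have hne : ∀ i, i ≠ j → s i = s' i := by
            intro i hi
            have := congrFun h i
            dsimp only at this
            rwa [Function.update_of_ne hi, Function.update_of_ne hi] at this
          funext i
          rcases eq_or_ne i j with rfl | hij
          · have a1 := hs.1
            have a2 := hs'.1
            rw [← Finset.add_sum_erase _ _ hj] at a1 a2
            have : ∑ x ∈ J.erase i, s x = ∑ x ∈ J.erase i, s' x :=
              Finset.sum_congr rfl fun x hx => hne x (Finset.ne_of_mem_erase hx)
            omega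
          · exact hne i hij
    _ = _ := by
        rw [Fintype.card_piFinset]
        have : ∀ i, (if i ∈ J.erase j then Finset.range (n + 1) else {0}).card =
            if i ∈ J.erase j then n + 1 else 1 := by intro i; split_ifs <;> simp
        simp only [this]
        rw [Finset.prod_ite_mem, Finset.univ_inter, Finset.prod_const, Finset.card_erase_of_mem hj]

/-- The full kernel polynomial. -/
def hcKer {d : ℕ} (J : Finset (Fin d)) (e t : Fin d → ℕ) (p : MvPolynomial (Fin d) ℂ) :
    MvPolynomial (Fin d) ℂ := (∏ j ∈ J, hcPhi j (e j) (t j)) * p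

theorem hcKer_insert {d : ℕ} {T : Finset (Fin d)} {j : Fin d} (hj : j ∉ T) (e t : Fin d → ℕ)
    (p : MvPolynomial (Fin d) ℂ) : hcKer (insert j T) e t p = hcPhi j (e j) (t j) * hcKer T e t p := by
  unfold hcKer
  rw [Finset.prod_insert hj, mul_assoc]

theorem hcKer_mem {d : ℕ} {J : Finset (Fin d)} {p : MvPolynomial (Fin d) ℂ} (hp : p ∈ hcI J ∅ 0)
    (T : Finset (Fin d)) (e t : Fin d → ℕ) : hcKer T e t p ∈ hcI (T ∪ J) ∅ 0 := by
  induction T using Finset.induction_on with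
  | empty => simpa [hcKer] using hp
  | insert j T hj ih =>
    rw [hcKer_insert hj]
    have := hcI_mul (Finset.disjoint_empty_left _) (hcI_zero_of (hcPhi_mem j (e j) (t j))) ih
    rw [Finset.insert_union, Finset.insert_eq]
    simpa using this

theorem hcKer_coeff {d : ℕ} {J : Finset (Fin d)} {p : MvPolynomial (Fin d) ℂ} (hp : p ∈ hcI J ∅ 0)
    (T : Finset (Fin d)) (hT : Disjoint T J) (e t : Fin d → ℕ) (m : Fin d →₀ ℕ) :
    coeff m (hcKer T e t p) = if ∀ j ∈ T, Nat.size (m j) = t j ∧ e j ≤ m j then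
      coeff (m.filter (· ∉ T)) p else 0 := by
  induction T using Finset.induction_on generalizing m with
  | empty =>
    have : m.filter (· ∉ (∅ : Finset (Fin d))) = m := by ext l; simp
    rw [this]; simp [hcKer]
  | insert j T hj ih =>
    rw [Finset.disjoint_insert_left] at hT
    have hj' : j ∉ T ∪ J := by rw [Finset.notMem_union]; exact ⟨hj, hT.1⟩
    rw [hcKer_insert hj, hc_coeff_phi_mul hj' (hcKer_mem hp T e t), ih hT.2]
    have hne : ∀ l ∈ T, (m.erase j) l = m l := fun l hl =>
      Finsupp.erase_ne (fun h => hj (h ▸ hl))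
    have h1 : (∀ l ∈ T, Nat.size ((m.erase j) l) = t l ∧ e l ≤ (m.erase j) l) ↔
        ∀ l ∈ T, Nat.size (m l) = t l ∧ e l ≤ m l :=
      forall₂_congr fun l hl => by rw [hne l hl]
    have h2 : (m.erase j).filter (· ∉ T) = m.filter (· ∉ insert j T) := by
      ext l
      simp only [Finsupp.filter_apply, Finset.mem_insert, not_or]
      rcases eq_or_ne l j with rfl | hl
      · simp
      · simp [Finsupp.erase_ne hl, hl]
    simp only [h1, h2, Finset.forall_mem_insert]
    split_ifs <;> first | rfl | (exfalso; tauto)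

theorem hcKer_eval {d : ℕ} (T : Finset (Fin d)) (e t : Fin d → ℕ) (he : ∀ j, e j ≤ 1)
    (p : MvPolynomial (Fin d) ℂ) (z : Fin d → ℂ) :
    ‖eval z (hcKer T e t p)‖ ≤ 2 ^ (∑ j ∈ T, t j) * (∏ j ∈ T, ‖eval z (hcGp j (t j))‖) * ‖eval z p‖ := by
  unfold hcKer
  rw [map_mul, norm_mul, map_prod, norm_prod, ← Finset.prod_pow_eq_pow_sum, ← Finset.prod_mul_distrib]
  gcongr with j hj
  exact hcPhi_eval j z (e j) (t j) (he j)
end HcPart6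

section HcPart7
open MvPolynomial

theorem hc_max_bound (x y B δ : ℝ) (hδ : 0 < δ) (hy : 0 ≤ y) (h1 : x ≤ B) (h2 : x * y ^ δ ≤ B) :
    x ≤ B * (max 1 y) ^ (-δ) := by
  rcases le_total y 1 with h | h
  · rw [max_eq_left h, Real.one_rpow, mul_one]; exact h1
  · rw [max_eq_right h, Real.rpow_neg hy, ← div_eq_mul_inv, le_div_iff₀ (by positivity)]; exact h2

theorem hc_ptwise {d : ℕ} (J : Finset (Fin d)) (hJ : J.Nonempty) (e : Fin d → ℕ) (he : ∀ j, e j ≤ 1)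
    (δ U : ℝ) (hδ : 0 < δ) (hδ1 : δ < 1) (hU : 0 ≤ U) (V : ℕ → MvPolynomial (Fin d) ℂ)
    (hV : ∀ z : Fin d → ℂ, (∀ j, ‖z j‖ = 1) → ∀ n, ‖eval z (V n)‖ ≤ U * 2 ^ n ∧
        ‖eval z (V n)‖ * (2 ^ n * ∏ j ∈ J, ‖z j - 1‖ / 2) ^ δ ≤ U * 2 ^ n)
    (z : Fin d → ℂ) (hz : ∀ j, ‖z j‖ = 1) (t : Fin d → ℕ) (n : ℕ) :
    ∃ s ∈ Finset.piAntidiag J n, ‖eval z (hcKer Jᶜ e t (V n))‖ ≤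
      (2 ^ (Jᶜ).card * (U * (2 ^ J.card) ^ δ)) * 2 ^ (∑ j ∈ Jᶜ, t j + n) *
        ∏ j, (max 1 ((2 : ℝ) ^ (if j ∈ J then s j else t j) * (‖z j - 1‖ / 2))) ^ (-δ) := by
  have ht1 : ∀ j, ‖z j - 1‖ / 2 ≤ 1 := fun j => by simpa using hc_tau_le_one {j} z hz
  obtain ⟨s, hs, hs2⟩ := hc_decomp J hJ (fun j => ‖z j - 1‖ / 2) (fun j => by positivity) ht1 n
  refine ⟨s, hs, ?_⟩
  have hg : ∀ j, ‖eval z (hcGp j (t j))‖ ≤ 2 * (max 1 ((2 : ℝ) ^ (t j) * (‖z j - 1‖ / 2))) ^ (-δ) := by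
    intro j
    have hG := hcGp_eval j z (hz j)
    refine hc_max_bound _ _ _ _ hδ (by positivity) ((hG.1 _).trans (by norm_num)) ?_
    have b1 := hG.1 (t j)
    have b2 := hG.2.1 (t j)
    dsimp only at b1 b2
    rcases le_total ((2 : ℝ) ^ (t j) * (‖z j - 1‖ / 2)) 1 with h | h
    · have : ((2 : ℝ) ^ (t j) * (‖z j - 1‖ / 2)) ^ δ ≤ 1 := Real.rpow_le_one (by positivity) h hδ.le
      have := mul_le_mul b1 this (by positivity) (by norm_num)
      linarith
    · refine le_trans ?_ b2
      gcongr
      calc ((2 : ℝ) ^ (t j) * (‖z j - 1‖ / 2)) ^ δ ≤ ((2 : ℝ) ^ (t j) * (‖z j - 1‖ / 2)) ^ (1 : ℝ) :=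
            Real.rpow_le_rpow_of_exponent_le h hδ1.le
        _ = _ := Real.rpow_one _
  have hv : ‖eval z (V n)‖ ≤ U * 2 ^ n * ((2 ^ J.card) ^ δ *
      ∏ j ∈ J, (max 1 ((2 : ℝ) ^ (s j) * (‖z j - 1‖ / 2))) ^ (-δ)) := by
    refine (hc_max_bound _ _ _ _ hδ (by positivity) (hV z hz n).1 (hV z hz n).2).trans ?_
    refine mul_le_mul_of_nonneg_left ?_ (by positivity)
    rw [Real.finset_prod_rpow _ _ (fun j _ => by positivity)]
    have h1 : (∏ j ∈ J, max 1 ((2 : ℝ) ^ (s j) * (‖z j - 1‖ / 2))) / 2 ^ J.card ≤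
        max 1 (2 ^ n * ∏ j ∈ J, ‖z j - 1‖ / 2) := by
      rw [div_le_iff₀ (by positivity), mul_comm]; exact hs2
    have h0 : 0 < ∏ j ∈ J, max 1 ((2 : ℝ) ^ (s j) * (‖z j - 1‖ / 2)) :=
      Finset.prod_pos fun j _ => by positivity
    calc _ ≤ ((∏ j ∈ J, max 1 ((2 : ℝ) ^ (s j) * (‖z j - 1‖ / 2))) / 2 ^ J.card) ^ (-δ) :=
          Real.rpow_le_rpow_of_nonpos (by positivity) h1 (by linarith)
      _ = _ := by
          rw [Real.div_rpow h0.le (by positivity), Real.rpow_neg (by positivity : (0:ℝ) ≤ 2 ^ J.card),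
            div_inv_eq_mul, mul_comm]
  refine (hcKer_eval Jᶜ e t he (V n) z).trans ?_
  have hsplit : ∏ j, (max 1 ((2 : ℝ) ^ (if j ∈ J then s j else t j) * (‖z j - 1‖ / 2))) ^ (-δ) =
      (∏ j ∈ J, (max 1 ((2 : ℝ) ^ (s j) * (‖z j - 1‖ / 2))) ^ (-δ)) *
      ∏ j ∈ Jᶜ, (max 1 ((2 : ℝ) ^ (t j) * (‖z j - 1‖ / 2))) ^ (-δ) := by
    rw [← Finset.prod_mul_prod_compl J]
    congr 1
    · exact Finset.prod_congr rfl fun j hj => by rw [if_pos hj]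
    · exact Finset.prod_congr rfl fun j hj => by rw [if_neg (Finset.mem_compl.1 hj)]
  rw [hsplit]
  calc _ ≤ 2 ^ (∑ j ∈ Jᶜ, t j) * (∏ j ∈ Jᶜ, (2 * (max 1 ((2 : ℝ) ^ (t j) * (‖z j - 1‖ / 2))) ^ (-δ))) *
        (U * 2 ^ n * ((2 ^ J.card) ^ δ * ∏ j ∈ J, (max 1 ((2 : ℝ) ^ (s j) * (‖z j - 1‖ / 2))) ^ (-δ))) := by
        gcongr with j hj
        exact hg j
    _ = _ := by
        rw [Finset.prod_mul_distrib, Finset.prod_const, pow_add]; ring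

theorem hc_sin_eq (sg u : ℝ) (h : sg = 1 ∨ sg = -1) :
    ‖Complex.exp (Complex.I * ((sg * u : ℝ) : ℂ)) - 1‖ / 2 = |Real.sin (u / 2)| := by
  rw [Complex.norm_exp_I_mul_ofReal_sub_one, norm_mul, Real.norm_eq_abs, Real.norm_eq_abs, abs_two,
    mul_div_cancel_left₀ _ (by norm_num)]
  rcases h with h | h
  · rw [h, one_mul]
  · rw [h]
    have : -1 * u / 2 = -(u / 2) := by ring
    rw [this, Real.sin_neg, abs_neg]

/-- Points of the polytorus attached to sign choice and shift. -/
def hcZ {d : ℕ} (sg : Fin d → ℝ) (x y : Fin d → ℝ) : Fin d → ℂ :=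
  fun j => Complex.exp (Complex.I * ((sg j * (x j - y j) : ℝ) : ℂ))

theorem hcZ_norm {d : ℕ} (sg : Fin d → ℝ) (x y : Fin d → ℝ) (j : Fin d) : ‖hcZ sg x y j‖ = 1 := by
  unfold hcZ; rw [mul_comm]; exact Complex.norm_exp_ofReal_mul_I _

theorem hcZ_cont {d : ℕ} (sg : Fin d → ℝ) (x : Fin d → ℝ) (P : MvPolynomial (Fin d) ℂ) :
    Continuous fun y => eval (hcZ sg x y) P := by
  have h1 : Continuous fun y => hcZ sg x y := by
    unfold hcZ
    fun_prop
  exact (MvPolynomial.continuous_eval P).comp h1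

theorem hc_Lp_bound {d : ℕ} (J : Finset (Fin d)) (hJ : J.Nonempty) (e : Fin d → ℕ) (he : ∀ j, e j ≤ 1)
    (δ U p : ℝ) (hδ : 0 < δ) (hδ1 : δ < 1) (hU : 0 ≤ U) (hp : 1 < p) (hpδ : 1 < δ * p)
    (V : ℕ → MvPolynomial (Fin d) ℂ)
    (hV : ∀ z : Fin d → ℂ, (∀ j, ‖z j‖ = 1) → ∀ n, ‖eval z (V n)‖ ≤ U * 2 ^ n ∧
        ‖eval z (V n)‖ * (2 ^ n * ∏ j ∈ J, ‖z j - 1‖ / 2) ^ δ ≤ U * 2 ^ n) :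
    ∃ C : ℝ, 0 ≤ C ∧ ∀ (sg : Fin d → ℝ) (_ : ∀ j, sg j = 1 ∨ sg j = -1) (x : Fin d → ℝ)
      (t : Fin d → ℕ) (n : ℕ),
      ∫ y, ‖eval (hcZ sg x y) (hcKer Jᶜ e t (V n))‖ ^ p ∂(torusMeasure d) ≤
        C * ((2 : ℝ) ^ (∑ j ∈ Jᶜ, t j + n)) ^ (p - 1) * ((n : ℝ) + 1) ^ (J.card - 1) := by
  obtain ⟨D, hD, HD⟩ := hc_H_int (δ * p) hpδ
  set B := (2 ^ (Jᶜ).card * (U * (2 ^ J.card) ^ δ)) with hB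
  have hB0 : 0 ≤ B := by positivity
  refine ⟨B ^ p * D ^ d, by positivity, ?_⟩
  intro sg hsg x t n
  set M := ∑ j ∈ Jᶜ, t j + n with hM
  set w : (Fin d → ℕ) → (Fin d → ℝ) → ℝ := fun s y =>
    ∏ j, (max 1 ((2 : ℝ) ^ (if j ∈ J then s j else t j) * |Real.sin ((x j - y j) / 2)|)) ^ (-(δ * p)) with hw
  have hw0 : ∀ s y, 0 ≤ w s y := fun s y => Finset.prod_nonneg fun j _ => by positivity
  have hwc : ∀ s, Continuous (w s) := by
    intro s
    refine continuous_finsetProd _ fun j _ => ?_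
    have : Continuous fun y : Fin d → ℝ =>
        max 1 ((2 : ℝ) ^ (if j ∈ J then s j else t j) * |Real.sin ((x j - y j) / 2)|) := by fun_prop
    exact this.rpow_const fun y => Or.inl (by positivity)
  have h1 : ∀ y, ‖eval (hcZ sg x y) (hcKer Jᶜ e t (V n))‖ ^ p ≤
      B ^ p * ((2 : ℝ) ^ M) ^ p * ∑ s ∈ Finset.piAntidiag J n, w s y := by
    intro y
    obtain ⟨s, hs, hs2⟩ := hc_ptwise J hJ e he δ U hδ hδ1 hU V hV (hcZ sg x y) (hcZ_norm sg x y) t n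
    have h2 : ∀ j, ‖hcZ sg x y j - 1‖ / 2 = |Real.sin ((x j - y j) / 2)| := fun j => hc_sin_eq _ _ (hsg j)
    simp only [h2] at hs2
    have h3 : 0 ≤ ∏ j, (max 1 ((2 : ℝ) ^ (if j ∈ J then s j else t j) * |Real.sin ((x j - y j) / 2)|)) ^ (-δ) :=
      Finset.prod_nonneg fun j _ => by positivity
    calc _ ≤ (B * 2 ^ M * ∏ j, (max 1 ((2 : ℝ) ^ (if j ∈ J then s j else t j) * |Real.sin ((x j - y j) / 2)|)) ^ (-δ)) ^ p :=
          Real.rpow_le_rpow (norm_nonneg _) hs2 (by linarith)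
      _ = B ^ p * ((2 : ℝ) ^ M) ^ p * w s y := by
          rw [Real.mul_rpow (by positivity) h3, Real.mul_rpow hB0 (by positivity),
            ← Real.finset_prod_rpow _ _ (fun j _ => by positivity)]
          congr 1
          refine Finset.prod_congr rfl fun j _ => ?_
          rw [← Real.rpow_mul (by positivity), neg_mul]
      _ ≤ _ := by
          refine mul_le_mul_of_nonneg_left ?_ (by positivity)
          exact Finset.single_le_sum (f := fun s => w s y) (fun s _ => hw0 s y) hs
  have h4 : ∀ s ∈ Finset.piAntidiag J n, ∫ y, w s y ∂(torusMeasure d) ≤ D ^ d * ((2 : ℝ) ^ M)⁻¹ := by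
    intro s hs
    rw [Finset.mem_piAntidiag] at hs
    have := hc_integral_prod d ℝ (fun j u =>
      (max 1 ((2 : ℝ) ^ (if j ∈ J then s j else t j) * |Real.sin ((x j - u) / 2)|)) ^ (-(δ * p)))
    simp only [hw]
    rw [this]
    calc _ ≤ ∏ j, (D * (2 ^ (if j ∈ J then s j else t j))⁻¹) := by
          refine Finset.prod_le_prod (fun j _ => ?_) fun j _ => HD _ _
          refine mul_nonneg (by simp; positivity) (integral_nonneg fun u => by positivity)
      _ = _ := by
          rw [Finset.prod_mul_distrib, Finset.prod_const, Finset.card_univ, Fintype.card_fin,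
            Finset.prod_inv_distrib, Finset.prod_pow_eq_pow_sum, ← Finset.sum_add_sum_compl J]
          rw [Finset.sum_congr rfl (fun j (hj : j ∈ J) => if_pos hj),
            Finset.sum_congr rfl (fun j (hj : j ∈ Jᶜ) => if_neg (Finset.mem_compl.1 hj)), hM]
          have : ∑ j ∈ J, s j = n := hs.1
          rw [this, add_comm n]
  have hPc : Continuous fun y => ‖eval (hcZ sg x y) (hcKer Jᶜ e t (V n))‖ ^ p :=
    (hcZ_cont sg x _).norm.rpow_const fun y => Or.inr (by linarith)
  calc _ ≤ ∫ y, B ^ p * ((2 : ℝ) ^ M) ^ p * ∑ s ∈ Finset.piAntidiag J n, w s y ∂(torusMeasure d) := by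
        refine integral_mono (hc_integrable d _ hPc) (hc_integrable d _ ?_) h1
        exact continuous_const.mul (continuous_finsetSum _ fun s _ => hwc s)
    _ = B ^ p * ((2 : ℝ) ^ M) ^ p * ∑ s ∈ Finset.piAntidiag J n, ∫ y, w s y ∂(torusMeasure d) := by
        rw [integral_const_mul, integral_finsetSum _ fun s _ => hc_integrable d _ (hwc s)]
    _ ≤ B ^ p * ((2 : ℝ) ^ M) ^ p * (((n : ℝ) + 1) ^ (J.card - 1) * (D ^ d * ((2 : ℝ) ^ M)⁻¹)) := by
        refine mul_le_mul_of_nonneg_left ?_ (by positivity)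
        refine (Finset.sum_le_card_nsmul _ _ _ h4).trans ?_
        rw [nsmul_eq_mul]
        gcongr
        exact_mod_cast hc_card_antidiag J hJ n
    _ = _ := by
        rw [Real.rpow_sub (by positivity), Real.rpow_one]; field_simp

theorem hc_conv_bound {d : ℕ} (J : Finset (Fin d)) (hJ : J.Nonempty) (e : Fin d → ℕ) (he : ∀ j, e j ≤ 1)
    (q : ℝ) (hq : 1 ≤ q) :
    ∃ C : ℝ, 0 ≤ C ∧ ∃ V : ℕ → MvPolynomial (Fin d) ℂ, (∀ n, V n ∈ hcI J ∅ 0) ∧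
      (∀ n (m : Fin d →₀ ℕ), (∀ j, j ∉ J → m j = 0) → ∑ j ∈ J, Nat.size (m j) ≤ n →
        coeff m (V n) = if ∀ j ∈ J, e j ≤ m j then 1 else 0) ∧
      ∀ (sg : Fin d → ℝ) (_ : ∀ j, sg j = 1 ∨ sg j = -1) (x : Fin d → ℝ)
      (t : Fin d → ℕ) (n : ℕ) (f : (Fin d → ℝ) → ℂ), Continuous f →
      ‖∫ y, f y * eval (hcZ sg x y) (hcKer Jᶜ e t (V n)) ∂(torusMeasure d)‖ ≤
        C * ((2 : ℝ) ^ (∑ j ∈ Jᶜ, t j + n)) ^ (1 / q) *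
          (((n : ℝ) + 1) ^ (J.card - 1)) ^ (1 - 1 / q) * torusLq d q f := by
  rcases eq_or_lt_of_le hq with rfl | hq1
  · obtain ⟨U, hU, V, hV, hVc, hVb⟩ := hc_kernel J (1 / 2) (by norm_num) (by norm_num) e he
    refine ⟨U, hU, V, hV, hVc, ?_⟩
    intro sg hsg x t n f hf
    have h1 : ∀ y, ‖eval (hcZ sg x y) (hcKer Jᶜ e t (V n))‖ ≤ U * 2 ^ (∑ j ∈ Jᶜ, t j + n) := by
      intro y
      refine (hcKer_eval Jᶜ e t he (V n) _).trans ?_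
      calc _ ≤ (2 : ℝ) ^ (∑ j ∈ Jᶜ, t j) * 1 * (U * 2 ^ n) := by
            gcongr
            · exact Finset.prod_le_one (fun _ _ => norm_nonneg _) fun j _ =>
                (hcGp_eval j _ (hcZ_norm sg x y j)).1 (t j)
            · exact (hVb _ (hcZ_norm sg x y) n).1
        _ = _ := by rw [pow_add]; ring
    have e1 : torusLq d 1 f = ∫ y, ‖f y‖ ∂(torusMeasure d) := by
      unfold torusLq; simp
    rw [e1]
    simp only [div_one, Real.rpow_one, sub_self, Real.rpow_zero, mul_one]
    refine (norm_integral_le_integral_norm _).trans ?_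
    rw [← integral_const_mul]
    refine integral_mono (hc_integrable d _ (hf.mul (hcZ_cont sg x _)).norm)
      (hc_integrable d _ (continuous_const.mul hf.norm)) fun y => ?_
    dsimp only
    rw [norm_mul, mul_comm]
    gcongr
    exact h1 y
  · set p := q / (q - 1) with hp
    have hpq : q.HolderConjugate p := Real.HolderConjugate.conjExponent hq1
    have hp1 : 1 < p := hpq.symm.lt
    have hinv : 1 / p = 1 - 1 / q := by
      have := hpq.inv_add_inv_eq_one
      rw [one_div, one_div]; linarith
    have hp0 : 0 < p := by linarith
    set δ := (1 + 1 / p) / 2 with hδ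
    have hip : 1 / p < 1 := by rw [div_lt_one hp0]; exact hp1
    have hip0 : 0 < 1 / p := by positivity
    have hδ0 : 0 < δ := by simp only [hδ]; linarith
    have hδ1 : δ < 1 := by simp only [hδ]; linarith
    have hpδ : 1 < δ * p := by
      have : δ * p = (p + 1) / 2 := by simp only [hδ]; field_simp
      rw [this]; linarith
    obtain ⟨U, hU, V, hV, hVc, hVb⟩ := hc_kernel J δ hδ0 hδ1 e he
    obtain ⟨C, hC, H⟩ := hc_Lp_bound J hJ e he δ U p hδ0 hδ1 hU hp1 hpδ V hVb
    refine ⟨C ^ (1 / p), by positivity, V, hV, hVc, ?_⟩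
    intro sg hsg x t n f hf
    refine (norm_integral_le_integral_norm _).trans ?_
    simp only [norm_mul]
    refine (integral_mul_norm_le_Lp_mul_Lq hpq (hc_memLp d f hf _) (hc_memLp d _ (hcZ_cont sg x _) _)).trans ?_
    rw [mul_comm]
    refine mul_le_mul_of_nonneg_right ?_ (by positivity)
    refine (Real.rpow_le_rpow (integral_nonneg fun y => by positivity) (H sg hsg x t n) (by positivity)).trans ?_
    rw [Real.mul_rpow (by positivity) (by positivity), Real.mul_rpow (by positivity) (by positivity),
      ← Real.rpow_mul (by positivity), hinv]
    have e2 : (p - 1) * (1 - 1 / q) = 1 / q := by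
      rw [← hinv]
      have : (p - 1) * (1 / p) = 1 - 1 / p := by field_simp
      rw [this, hinv]; ring
    rw [e2]
end HcPart7

section HcPart8
open MvPolynomial

theorem hc_cross_size {d : ℕ} {γ : Fin d → ℝ} (hγ : ∀ j, 0 ≤ γ j) {n : ℕ} {k : Fin d → ℤ}
    (hk : k ∈ hyperbolicCross d γ n) : ∑ j, γ j * (Nat.size (k j).natAbs : ℝ) ≤ n := by
  obtain ⟨s, hs, h⟩ := hk
  refine le_trans (Finset.sum_le_sum fun j _ => ?_) hs
  refine mul_le_mul_of_nonneg_left ?_ (hγ j)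
  have h1 := (h j).2
  rw [Int.abs_eq_natAbs] at h1
  exact_mod_cast Nat.size_le.2 (by exact_mod_cast h1)

theorem hc_exp_prod {d : ℕ} (k : Fin d → ℤ) (x : Fin d → ℝ) :
    Complex.exp (Complex.I * ∑ j, (k j : ℂ) * (x j : ℂ)) =
      ∏ j, Complex.exp (Complex.I * ((k j : ℂ) * (x j : ℂ))) := by
  rw [Finset.mul_sum, Complex.exp_sum]

theorem hc_conv_mono {d : ℕ} (k : Fin d → ℤ) (x : Fin d → ℝ) (s : Fin d → ℤ) (m : Fin d →₀ ℕ) :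
    ∫ y, Complex.exp (Complex.I * ∑ j, (k j : ℂ) * (y j : ℂ)) *
      ∏ j, hcZ (fun j => ((s j : ℤ) : ℝ)) x y j ^ m j ∂(torusMeasure d) =
    if ∀ j, k j = s j * m j then Complex.exp (Complex.I * ∑ j, (k j : ℂ) * (x j : ℂ)) else 0 := by
  have h1 : ∀ y : Fin d → ℝ, Complex.exp (Complex.I * ∑ j, (k j : ℂ) * (y j : ℂ)) *
      ∏ j, hcZ (fun j => ((s j : ℤ) : ℝ)) x y j ^ m j =
      ∏ j, (Complex.exp (Complex.I * ((s j * m j : ℤ) * (x j : ℂ))) *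
        Complex.exp (Complex.I * (((k j - s j * m j : ℤ) : ℂ) * (y j : ℂ)))) := by
    intro y
    rw [hc_exp_prod, ← Finset.prod_mul_distrib]
    refine Finset.prod_congr rfl fun j _ => ?_
    unfold hcZ
    rw [← Complex.exp_nat_mul, ← Complex.exp_add, ← Complex.exp_add]
    congr 1
    push_cast
    ring
  simp only [h1]
  rw [hc_integral_prod d ℂ (fun j u => Complex.exp (Complex.I * ((s j * m j : ℤ) * (x j : ℂ))) *
        Complex.exp (Complex.I * (((k j - s j * m j : ℤ) : ℂ) * (u : ℂ))))]
  have h2 : ∀ j, ((((2 * Real.pi)⁻¹ : ℝ) : ℂ) * ∫ u in Set.Ico 0 (2 * Real.pi),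
      Complex.exp (Complex.I * ((s j * m j : ℤ) * (x j : ℂ))) *
        Complex.exp (Complex.I * (((k j - s j * m j : ℤ) : ℂ) * (u : ℂ)))) =
      if k j = s j * m j then Complex.exp (Complex.I * ((k j : ℂ) * (x j : ℂ))) else 0 := by
    intro j
    rw [integral_const_mul, mul_left_comm, hc_orth1]
    by_cases h : k j = s j * m j
    · rw [if_pos h, if_pos (by omega), mul_one, h]
    · rw [if_neg h, if_neg (by omega), mul_zero]
  refine (Finset.prod_congr rfl fun j _ => h2 j).trans ?_
  split_ifs with h
  · rw [hc_exp_prod]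
    exact Finset.prod_congr rfl fun j _ => if_pos (h j)
  · push Not at h
    obtain ⟨j, hj⟩ := h
    exact Finset.prod_eq_zero (Finset.mem_univ j) (if_neg hj)

/-- Absolute values of a frequency as an exponent. -/
def hcAbs {d : ℕ} (k : Fin d → ℤ) : Fin d →₀ ℕ := Finsupp.equivFunOnFinite.symm fun j => (k j).natAbs

theorem hc_conv {d : ℕ} (k : Fin d → ℤ) (x : Fin d → ℝ) (s : Fin d → ℤ) (hs : ∀ j, s j = 1 ∨ s j = -1)
    (P : MvPolynomial (Fin d) ℂ) :
    ∫ y, Complex.exp (Complex.I * ∑ j, (k j : ℂ) * (y j : ℂ)) *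
      eval (hcZ (fun j => ((s j : ℤ) : ℝ)) x y) P ∂(torusMeasure d) =
    if ∀ j, k j = s j * (k j).natAbs then
      coeff (hcAbs k) P * Complex.exp (Complex.I * ∑ j, (k j : ℂ) * (x j : ℂ)) else 0 := by
  have h1 : ∀ y, Complex.exp (Complex.I * ∑ j, (k j : ℂ) * (y j : ℂ)) *
      eval (hcZ (fun j => ((s j : ℤ) : ℝ)) x y) P = ∑ m ∈ P.support, coeff m P *
      (Complex.exp (Complex.I * ∑ j, (k j : ℂ) * (y j : ℂ)) *
      ∏ j, hcZ (fun j => ((s j : ℤ) : ℝ)) x y j ^ m j) := by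
    intro y
    rw [eval_eq', Finset.mul_sum]
    exact Finset.sum_congr rfl fun m _ => by ring
  simp only [h1]
  rw [integral_finsetSum]
  swap
  · intro m _
    apply hc_integrable
    unfold hcZ
    fun_prop
  simp only [integral_const_mul, hc_conv_mono]
  have h2 : ∀ m : Fin d →₀ ℕ, (∀ j, k j = s j * m j) ↔ m = hcAbs k ∧ ∀ j, k j = s j * (k j).natAbs := by
    intro m
    constructor
    · intro h
      have : m = hcAbs k := by
        ext j
        have := h j
        simp only [hcAbs, Finsupp.equivFunOnFinite_symm_apply_apply]
        rcases hs j with h' | h' <;> rw [h'] at this <;> omega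
      refine ⟨this, fun j => ?_⟩
      have h3 := h j
      rw [this] at h3
      exact h3
    · rintro ⟨rfl, h⟩ j
      exact h j
  by_cases h : ∀ j, k j = s j * (k j).natAbs
  · rw [if_pos h]
    have h4 : ∀ m : Fin d →₀ ℕ, (∀ j, k j = s j * m j) ↔ m = hcAbs k := fun m =>
      (h2 m).trans (and_iff_left h)
    simp only [h4, mul_ite, mul_zero]
    rw [Finset.sum_ite_eq']
    split_ifs with h3
    · rfl
    · rw [notMem_support_iff.1 h3, zero_mul]
  · rw [if_neg h]
    refine Finset.sum_eq_zero fun m _ => ?_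
    rw [if_neg (fun h' => h ((h2 m).1 h').2), mul_zero]

/-- Sign attached to a Boolean. -/
def hcSg (b : Bool) : ℤ := if b then -1 else 1
/-- Least admissible modulus attached to a Boolean sign. -/
def hcE (b : Bool) : ℕ := if b then 1 else 0

theorem hc_sign_iff (k : ℤ) (b : Bool) :
    (k = hcSg b * k.natAbs ∧ hcE b ≤ k.natAbs) ↔ b = decide (k < 0) := by
  cases b
  · have h : (false = decide (k < 0)) ↔ ¬ k < 0 := by simp
    rw [h]
    simp only [hcSg, hcE, Bool.false_eq_true, if_false]
    omega
  · have h : (true = decide (k < 0)) ↔ k < 0 := by simp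
    rw [h]
    simp only [hcSg, hcE, if_true]
    omega

/-- The remaining budget on the coordinates of weight one. -/
def hcN {d : ℕ} (J : Finset (Fin d)) (γ : Fin d → ℝ) (n : ℕ) (t : Fin d → ℕ) : ℕ :=
  ⌊(n : ℝ) - ∑ j ∈ Jᶜ, γ j * (t j : ℝ)⌋₊

/-- The index set for the coordinates of weight larger than one. -/
def hcS {d : ℕ} (J : Finset (Fin d)) (γ : Fin d → ℝ) (n : ℕ) : Finset (Fin d → ℕ) :=
  (Fintype.piFinset (fun j => if j ∈ J then {0} else Finset.range (n + 1))).filter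
    (fun t => ∑ j ∈ Jᶜ, γ j * (t j : ℝ) ≤ n)

theorem hc_coeff_main {d : ℕ} (J : Finset (Fin d)) (γ : Fin d → ℝ) (hγ : ∀ j ∈ J, γ j = 1)
    (n : ℕ) (k : Fin d → ℤ) (hk : ∑ j, γ j * (Nat.size (k j).natAbs : ℝ) ≤ n)
    (e t : Fin d → ℕ) (V : ℕ → MvPolynomial (Fin d) ℂ) (hV : ∀ n, V n ∈ hcI J ∅ 0)
    (hVc : ∀ n (m : Fin d →₀ ℕ), (∀ j, j ∉ J → m j = 0) → ∑ j ∈ J, Nat.size (m j) ≤ n →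
      coeff m (V n) = if ∀ j ∈ J, e j ≤ m j then 1 else 0) :
    coeff (hcAbs k) (hcKer Jᶜ e t (V (hcN J γ n t))) =
      if (∀ j ∈ Jᶜ, Nat.size (k j).natAbs = t j) ∧ ∀ j, e j ≤ (k j).natAbs then 1 else 0 := by
  rw [hcKer_coeff (hV _) _ disjoint_compl_left]
  have ha : ∀ j, hcAbs k j = (k j).natAbs := fun j => rfl
  simp only [ha]
  by_cases h : ∀ j ∈ Jᶜ, Nat.size (k j).natAbs = t j
  swap
  · rw [if_neg, if_neg]
    · exact fun h' => h h'.1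
    · exact fun h' => h fun j hj => (h' j hj).1
  have hf : ∀ j ∈ J, ((hcAbs k).filter (· ∉ Jᶜ)) j = (k j).natAbs := by
    intro j hj
    rw [Finsupp.filter_apply_pos]
    · rfl
    · simpa using hj
  rw [hVc]
  · by_cases h1 : ∀ j, e j ≤ (k j).natAbs
    · have hin : ∀ j ∈ J, e j ≤ ((hcAbs k).filter (· ∉ Jᶜ)) j := by
        intro j hj
        rw [hf j hj]; exact h1 j
      have hout : ∀ j ∈ Jᶜ, Nat.size (k j).natAbs = t j ∧ e j ≤ (k j).natAbs :=
        fun j hj => ⟨h j hj, h1 j⟩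
      have hr : (∀ j ∈ Jᶜ, Nat.size (k j).natAbs = t j) ∧ ∀ j, e j ≤ (k j).natAbs := ⟨h, h1⟩
      rw [if_pos hout, if_pos hin, if_pos hr]
    · have hr : ¬ ((∀ j ∈ Jᶜ, Nat.size (k j).natAbs = t j) ∧ ∀ j, e j ≤ (k j).natAbs) :=
        fun h' => h1 h'.2
      rw [if_neg hr]
      by_cases h2 : ∀ j ∈ Jᶜ, Nat.size (k j).natAbs = t j ∧ e j ≤ (k j).natAbs
      · rw [if_pos h2, if_neg]
        intro h3
        apply h1
        intro j
        by_cases hj : j ∈ J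
        · have := h3 j hj
          rwa [hf j hj] at this
        · exact (h2 j (by simpa using hj)).2
      · rw [if_neg h2]
  · intro j hj
    rw [Finsupp.filter_apply_neg]
    simpa using hj
  · rw [Finset.sum_congr rfl fun j hj => by rw [hf j hj]]
    refine Nat.le_floor ?_
    have h2 := Finset.sum_add_sum_compl J fun j => γ j * (Nat.size (k j).natAbs : ℝ)
    have h3 : ∑ j ∈ Jᶜ, γ j * (Nat.size (k j).natAbs : ℝ) = ∑ j ∈ Jᶜ, γ j * (t j : ℝ) :=
      Finset.sum_congr rfl fun j hj => by rw [h j hj]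
    have h4 : ∑ j ∈ J, γ j * (Nat.size (k j).natAbs : ℝ) = ((∑ j ∈ J, Nat.size (k j).natAbs : ℕ) : ℝ) := by
      push_cast
      exact Finset.sum_congr rfl fun j hj => by rw [hγ j hj, one_mul]
    linarith

theorem hc_repro_exp {d : ℕ} (J : Finset (Fin d)) (γ : Fin d → ℝ) (hγ : ∀ j ∈ J, γ j = 1)
    (hγ' : ∀ j, 1 ≤ γ j)
    (n : ℕ) (k : Fin d → ℤ) (hk : ∑ j, γ j * (Nat.size (k j).natAbs : ℝ) ≤ n) (x : Fin d → ℝ)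
    (V : (Fin d → Bool) → ℕ → MvPolynomial (Fin d) ℂ) (hV : ∀ σ n, V σ n ∈ hcI J ∅ 0)
    (hVc : ∀ σ n (m : Fin d →₀ ℕ), (∀ j, j ∉ J → m j = 0) → ∑ j ∈ J, Nat.size (m j) ≤ n →
      coeff m (V σ n) = if ∀ j ∈ J, hcE (σ j) ≤ m j then 1 else 0) :
    ∑ σ : Fin d → Bool, ∑ t ∈ hcS J γ n,
      ∫ y, Complex.exp (Complex.I * ∑ j, (k j : ℂ) * (y j : ℂ)) *
        eval (hcZ (fun j => ((hcSg (σ j) : ℤ) : ℝ)) x y)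
          (hcKer Jᶜ (fun j => hcE (σ j)) t (V σ (hcN J γ n t))) ∂(torusMeasure d) =
    Complex.exp (Complex.I * ∑ j, (k j : ℂ) * (x j : ℂ)) := by
  have hs : ∀ b, hcSg b = 1 ∨ hcSg b = -1 := by intro b; cases b <;> simp [hcSg]
  set t0 : Fin d → ℕ := fun j => if j ∈ J then 0 else Nat.size (k j).natAbs with ht0
  set σ0 : Fin d → Bool := fun j => decide (k j < 0) with hσ0
  have hpos : ∀ j, (0 : ℝ) ≤ γ j * (Nat.size (k j).natAbs : ℝ) := fun j =>
    mul_nonneg (by linarith [hγ' j]) (Nat.cast_nonneg _)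
  have ht0S : t0 ∈ hcS J γ n := by
    unfold hcS
    rw [Finset.mem_filter, Fintype.mem_piFinset]
    constructor
    · intro j
      by_cases hj : j ∈ J
      · simp [ht0, hj]
      · simp only [ht0, hj, if_false, Finset.mem_range]
        have h1 := Finset.single_le_sum (fun j _ => hpos j) (Finset.mem_univ j)
        have h2 : (1 : ℝ) * (Nat.size (k j).natAbs : ℝ) ≤ γ j * (Nat.size (k j).natAbs : ℝ) :=
          mul_le_mul_of_nonneg_right (hγ' j) (Nat.cast_nonneg _)
        have h3 : (Nat.size (k j).natAbs : ℝ) ≤ n := by linarith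
        have h4 : Nat.size (k j).natAbs ≤ n := by exact_mod_cast h3
        omega
    · have h1 : ∑ j ∈ Jᶜ, γ j * (t0 j : ℝ) = ∑ j ∈ Jᶜ, γ j * (Nat.size (k j).natAbs : ℝ) :=
        Finset.sum_congr rfl fun j hj => by
          have : j ∉ J := by simpa using hj
          simp [ht0, this]
      rw [h1]
      exact le_trans (Finset.sum_le_sum_of_subset_of_nonneg (Finset.subset_univ _) fun j _ _ => hpos j) hk
  have key : ∀ σ, ∀ t ∈ hcS J γ n,
      ∫ y, Complex.exp (Complex.I * ∑ j, (k j : ℂ) * (y j : ℂ)) *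
        eval (hcZ (fun j => ((hcSg (σ j) : ℤ) : ℝ)) x y)
          (hcKer Jᶜ (fun j => hcE (σ j)) t (V σ (hcN J γ n t))) ∂(torusMeasure d) =
      if σ = σ0 then if t = t0 then Complex.exp (Complex.I * ∑ j, (k j : ℂ) * (x j : ℂ)) else 0 else 0 := by
    intro σ t ht
    rw [hc_conv k x (fun j => hcSg (σ j)) (fun j => hs _),
      hc_coeff_main J γ hγ n k hk _ t (V σ) (hV σ) (hVc σ)]
    have ht' : ∀ j ∈ J, t j = 0 := by
      intro j hj
      unfold hcS at ht
      rw [Finset.mem_filter, Fintype.mem_piFinset] at ht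
      simpa [hj] using ht.1 j
    have e1 : (∀ j ∈ Jᶜ, Nat.size (k j).natAbs = t j) ↔ t = t0 := by
      constructor
      · intro h
        funext j
        by_cases hj : j ∈ J
        · simp [ht0, hj, ht' j hj]
        · simp [ht0, hj, h j (by simpa using hj)]
      · rintro rfl j hj
        have : j ∉ J := by simpa using hj
        simp [ht0, this]
    have e2 : ((∀ j, k j = hcSg (σ j) * (k j).natAbs) ∧ ∀ j, hcE (σ j) ≤ (k j).natAbs) ↔ σ = σ0 := by
      rw [← forall_and, funext_iff]
      exact forall_congr' fun j => hc_sign_iff _ _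
    by_cases h1 : ∀ j, k j = hcSg (σ j) * (k j).natAbs
    · rw [if_pos h1]
      by_cases h2 : ∀ j, hcE (σ j) ≤ (k j).natAbs
      · rw [if_pos (e2.1 ⟨h1, h2⟩)]
        by_cases h3 : t = t0
        · rw [if_pos h3, if_pos (And.intro (e1.2 h3) h2), one_mul]
        · rw [if_neg h3, if_neg (fun h => h3 (e1.1 (And.left h))), zero_mul]
      · have hr : ¬ ((∀ j ∈ Jᶜ, Nat.size (k j).natAbs = t j) ∧ ∀ j, hcE (σ j) ≤ (k j).natAbs) :=
          fun h' => h2 h'.2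
        have hr2 : ¬ σ = σ0 := fun h => h2 (e2.2 h).2
        rw [if_neg hr, if_neg hr2, zero_mul]
    · have hr2 : ¬ σ = σ0 := fun h => h1 (e2.2 h).1
      rw [if_neg h1, if_neg hr2]
  rw [Finset.sum_congr rfl fun σ _ => Finset.sum_congr rfl fun t ht => key σ t ht]
  rw [Finset.sum_eq_single σ0 (by intro b _ hb; simp [hb]) (by simp)]
  simp [ht0S]

theorem hc_repro {d : ℕ} (J : Finset (Fin d)) (γ : Fin d → ℝ) (hγ : ∀ j ∈ J, γ j = 1)
    (hγ' : ∀ j, 1 ≤ γ j) (n : ℕ) (x : Fin d → ℝ)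
    (V : (Fin d → Bool) → ℕ → MvPolynomial (Fin d) ℂ) (hV : ∀ σ n, V σ n ∈ hcI J ∅ 0)
    (hVc : ∀ σ n (m : Fin d →₀ ℕ), (∀ j, j ∉ J → m j = 0) → ∑ j ∈ J, Nat.size (m j) ≤ n →
      coeff m (V σ n) = if ∀ j ∈ J, hcE (σ j) ≤ m j then 1 else 0)
    (f : (Fin d → ℝ) → ℂ) (hf : IsTrigPoly d (hyperbolicCross d γ n) f) :
    Continuous f ∧ ∑ σ : Fin d → Bool, ∑ t ∈ hcS J γ n,
      ∫ y, f y *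
        eval (hcZ (fun j => ((hcSg (σ j) : ℤ) : ℝ)) x y)
          (hcKer Jᶜ (fun j => hcE (σ j)) t (V σ (hcN J γ n t))) ∂(torusMeasure d) = f x := by
  obtain ⟨F, hF, c, hc⟩ := hf
  obtain rfl : f = fun x => ∑ k ∈ F, c k * Complex.exp (Complex.I * ∑ j, (k j : ℂ) * (x j : ℂ)) := funext hc
  refine ⟨by fun_prop, ?_⟩
  have h1 : ∀ P : MvPolynomial (Fin d) ℂ, ∀ sg : Fin d → ℝ, ∫ y, (∑ k ∈ F, c k * Complex.exp (Complex.I * ∑ j, (k j : ℂ) * (y j : ℂ))) *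
      eval (hcZ sg x y) P ∂(torusMeasure d) = ∑ k ∈ F, c k *
      ∫ y, Complex.exp (Complex.I * ∑ j, (k j : ℂ) * (y j : ℂ)) * eval (hcZ sg x y) P ∂(torusMeasure d) := by
    intro P sg
    simp only [Finset.sum_mul, mul_assoc]
    rw [integral_finsetSum]
    · simp only [integral_const_mul]
    · intro k _
      apply hc_integrable
      refine continuous_const.mul (Continuous.mul (by fun_prop) (hcZ_cont sg x P))
  simp only [h1]
  rw [Finset.sum_congr rfl fun σ _ => Finset.sum_comm, Finset.sum_comm]
  refine Finset.sum_congr rfl fun k hk => ?_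
  simp only [← Finset.mul_sum]
  rw [hc_repro_exp J γ hγ hγ' n k (hc_cross_size (fun j => by linarith [hγ' j]) (hF hk)) x V hV hVc]

theorem hc_sum_bound {d : ℕ} (J : Finset (Fin d)) (γ : Fin d → ℝ) (hγ : ∀ j ∈ Jᶜ, 1 < γ j)
    (q : ℝ) (hq : 1 ≤ q) (n : ℕ) :
    ∑ t ∈ hcS J γ n, ((2 : ℝ) ^ (∑ j ∈ Jᶜ, t j + hcN J γ n t)) ^ (1 / q) ≤
      (2 : ℝ) ^ ((n : ℝ) / q) * ∏ j, (if j ∈ J then 1 else (1 - (2 : ℝ) ^ (-(γ j - 1) / q))⁻¹) := by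
  have hq0 : 0 < q := by linarith
  have h1 : ∀ t ∈ hcS J γ n, ((2 : ℝ) ^ (∑ j ∈ Jᶜ, t j + hcN J γ n t)) ^ (1 / q) ≤
      (2 : ℝ) ^ ((n : ℝ) / q) * ∏ j, (if j ∈ J then 1 else ((2 : ℝ) ^ (-(γ j - 1) / q)) ^ t j) := by
    intro t ht
    unfold hcS at ht
    rw [Finset.mem_filter] at ht
    have h2 : (hcN J γ n t : ℝ) ≤ (n : ℝ) - ∑ j ∈ Jᶜ, γ j * (t j : ℝ) := Nat.floor_le (by linarith [ht.2])
    have e1 : ∏ j, (if j ∈ J then 1 else ((2 : ℝ) ^ (-(γ j - 1) / q)) ^ t j) =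
        (2 : ℝ) ^ (∑ j ∈ Jᶜ, (-(γ j - 1) / q * (t j : ℝ))) := by
      rw [Real.rpow_sum_of_pos (by norm_num), ← Finset.prod_mul_prod_compl J,
        Finset.prod_eq_one fun j hj => if_pos hj, one_mul]
      refine Finset.prod_congr rfl fun j hj => ?_
      rw [if_neg (by simpa using hj), ← Real.rpow_natCast, ← Real.rpow_mul (by norm_num)]
    rw [e1, ← Real.rpow_add (by norm_num), ← Real.rpow_natCast, ← Real.rpow_mul (by norm_num)]
    refine Real.rpow_le_rpow_of_exponent_le (by norm_num) ?_
    have e2 : (n : ℝ) / q + ∑ j ∈ Jᶜ, (-(γ j - 1) / q * (t j : ℝ)) =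
        ((n : ℝ) - ∑ j ∈ Jᶜ, γ j * (t j : ℝ) + ∑ j ∈ Jᶜ, (t j : ℝ)) * (1 / q) := by
      have : ∑ j ∈ Jᶜ, (-(γ j - 1) / q * (t j : ℝ)) =
          (∑ j ∈ Jᶜ, (t j : ℝ) - ∑ j ∈ Jᶜ, γ j * (t j : ℝ)) * (1 / q) := by
        rw [← Finset.sum_sub_distrib, Finset.sum_mul]
        exact Finset.sum_congr rfl fun j _ => by ring
      rw [this]; ring
    rw [e2]
    refine mul_le_mul_of_nonneg_right ?_ (by positivity)
    push_cast
    linarith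
  refine (Finset.sum_le_sum h1).trans ?_
  rw [← Finset.mul_sum]
  refine mul_le_mul_of_nonneg_left ?_ (by positivity)
  unfold hcS
  have hnn : ∀ j (i : ℕ), 0 ≤ (if j ∈ J then 1 else ((2 : ℝ) ^ (-(γ j - 1) / q)) ^ i) := by
    intro j i
    split_ifs <;> positivity
  refine (Finset.sum_le_sum_of_subset_of_nonneg (Finset.filter_subset _ _) fun t _ _ =>
    Finset.prod_nonneg fun j _ => hnn j (t j)).trans ?_
  rw [← Finset.prod_univ_sum (fun j => if j ∈ J then {0} else Finset.range (n + 1))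
    (fun j i => if j ∈ J then 1 else ((2 : ℝ) ^ (-(γ j - 1) / q)) ^ i)]
  refine Finset.prod_le_prod (fun j _ => Finset.sum_nonneg fun i _ => hnn j i) fun j _ => ?_
  by_cases hj : j ∈ J
  · simp [hj]
  · simp only [hj, if_false]
    refine hc_geom_le (by positivity) (Real.rpow_lt_one_of_one_lt_of_neg (by norm_num) ?_)
    have := hγ j (by simpa using hj)
    exact div_neg_of_neg_of_pos (by linarith) hq0

theorem hc_final (d ν : ℕ) (γ : Fin d → ℝ) (q : ℝ) (hq : 1 ≤ q)
    (hν : 1 ≤ ν) (hνd : ν ≤ d)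
    (hγ1 : ∀ j : Fin d, (j : ℕ) < ν → γ j = 1)
    (hγ2 : ∀ j : Fin d, ν ≤ (j : ℕ) → 1 < γ j) :
    ∃ C : ℝ, 0 < C ∧
      ∀ n : ℕ, 1 ≤ n →
        ∀ f : (Fin d → ℝ) → ℂ, IsTrigPoly d (hyperbolicCross d γ n) f →
          torusSupC d f ≤
            C * (2 : ℝ) ^ ((n : ℝ) / q) * (n : ℝ) ^ (((ν : ℝ) - 1) * (1 - 1 / q)) *
              torusLq d q f := by
  set J : Finset (Fin d) := Finset.univ.filter fun j => (j : ℕ) < ν with hJd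
  have hJ : J.Nonempty := ⟨⟨0, by omega⟩, by simp [hJd]; omega⟩
  have hJc : J.card ≤ ν := by
    have : J.image (fun j : Fin d => (j : ℕ)) ⊆ Finset.range ν := by
      intro i hi
      obtain ⟨j, hj, rfl⟩ := Finset.mem_image.1 hi
      simpa [hJd] using hj
    have h2 := Finset.card_le_card this
    rwa [Finset.card_image_of_injective _ Fin.val_injective, Finset.card_range] at h2
  have hγJ : ∀ j ∈ J, γ j = 1 := fun j hj => hγ1 j (by simpa [hJd] using hj)
  have hγT : ∀ j ∈ Jᶜ, 1 < γ j := fun j hj => hγ2 j (by simpa [hJd] using hj)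
  have hγ' : ∀ j, 1 ≤ γ j := by
    intro j
    by_cases hj : j ∈ J
    · exact (hγJ j hj).ge
    · exact (hγT j (by simpa using hj)).le
  have hb := fun σ : Fin d → Bool => hc_conv_bound J hJ (fun j => hcE (σ j))
    (fun j => by cases σ j <;> simp [hcE]) q hq
  choose C hC V hV hVc hB using hb
  set D : ℝ := ∏ j, (if j ∈ J then 1 else (1 - (2 : ℝ) ^ (-(γ j - 1) / q))⁻¹) with hD
  have hq0 : 0 < q := by linarith
  have hD0 : 0 ≤ D := by
    refine Finset.prod_nonneg fun j _ => ?_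
    split_ifs with hj
    · norm_num
    · have := hγT j (by simpa using hj)
      rw [inv_nonneg, sub_nonneg]
      exact (Real.rpow_lt_one_of_one_lt_of_neg (by norm_num)
        (div_neg_of_neg_of_pos (by linarith) hq0)).le
  have hr : 0 ≤ 1 - 1 / q := by
    rw [sub_nonneg, div_le_one hq0]; exact hq
  set A : ℝ := (2 : ℝ) ^ (((ν : ℝ) - 1) * (1 - 1 / q)) with hA
  have hCs : 0 ≤ ∑ σ, C σ := Finset.sum_nonneg fun σ _ => hC σ
  refine ⟨(∑ σ, C σ) * D * A + 1, by positivity, ?_⟩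
  intro n hn f hf
  have hn1 : (1 : ℝ) ≤ n := by exact_mod_cast hn
  have hLq : 0 ≤ torusLq d q f := by
    unfold torusLq
    exact Real.rpow_nonneg (integral_nonneg fun y => by positivity) _
  have hne : Nonempty (torusCell d) := ⟨⟨fun _ => 0, by
    intro j _
    exact ⟨le_refl _, by positivity⟩⟩⟩
  unfold torusSupC
  refine ciSup_le fun x => ?_
  obtain ⟨hfc, hfx⟩ := hc_repro J γ hγJ hγ' n x.1 V hV hVc f hf
  set N : ℝ := (n : ℝ) ^ (((ν : ℝ) - 1) * (1 - 1 / q)) with hN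
  have hw : ∀ t, ((((hcN J γ n t : ℕ) : ℝ) + 1) ^ (J.card - 1)) ^ (1 - 1 / q) ≤ A * N := by
    intro t
    have h1 : ((hcN J γ n t : ℕ) : ℝ) ≤ n := by
      have : hcN J γ n t ≤ n := by
        refine (Nat.floor_mono ?_).trans (Nat.floor_natCast (R := ℝ) n).le
        rw [sub_le_self_iff]
        exact Finset.sum_nonneg fun j _ => mul_nonneg (by linarith [hγ' j]) (Nat.cast_nonneg _)
      exact_mod_cast this
    rw [hA, hN, ← Real.mul_rpow (by norm_num) (by positivity), Real.rpow_mul (by positivity)]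
    refine Real.rpow_le_rpow (by positivity) ?_ hr
    have e1 : ((ν : ℝ) - 1) = ((ν - 1 : ℕ) : ℝ) := by push_cast [hν]; ring
    rw [e1, Real.rpow_natCast]
    calc _ ≤ (2 * (n : ℝ)) ^ (J.card - 1) := pow_le_pow_left₀ (by positivity) (by linarith) _
      _ ≤ _ := pow_le_pow_right₀ (by linarith) (by omega)
  rw [← hfx]
  have hAN : 0 ≤ A * N := by positivity
  have hsgn : ∀ b, ((hcSg b : ℤ) : ℝ) = 1 ∨ ((hcSg b : ℤ) : ℝ) = -1 := by
    intro b; cases b <;> simp [hcSg]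
  calc _ ≤ ∑ σ : Fin d → Bool, ∑ t ∈ hcS J γ n,
        C σ * ((2 : ℝ) ^ (∑ j ∈ Jᶜ, t j + hcN J γ n t)) ^ (1 / q) * (A * N) * torusLq d q f := by
        refine (norm_sum_le _ _).trans (Finset.sum_le_sum fun σ _ => ?_)
        refine (norm_sum_le _ _).trans (Finset.sum_le_sum fun t _ => ?_)
        refine (hB σ _ (fun j => hsgn (σ j)) x.1 t (hcN J γ n t) f hfc).trans ?_
        refine mul_le_mul_of_nonneg_right ?_ hLq
        refine mul_le_mul_of_nonneg_left (hw t) ?_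
        have := hC σ
        positivity
    _ = (∑ σ, C σ) * (∑ t ∈ hcS J γ n, ((2 : ℝ) ^ (∑ j ∈ Jᶜ, t j + hcN J γ n t)) ^ (1 / q)) *
          (A * N) * torusLq d q f := by
        rw [Finset.sum_mul_sum, Finset.sum_mul, Finset.sum_mul]
        refine Finset.sum_congr rfl fun σ _ => ?_
        rw [Finset.sum_mul, Finset.sum_mul]
    _ ≤ (∑ σ, C σ) * ((2 : ℝ) ^ ((n : ℝ) / q) * D) * (A * N) * torusLq d q f := by
        gcongr
        exact hc_sum_bound J γ hγT q hq n
    _ = ((∑ σ, C σ) * D * A) * (2 : ℝ) ^ ((n : ℝ) / q) * N * torusLq d q f := by ring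
    _ ≤ _ := by
        gcongr
        linarith
end HcPart8

/-- Nikol'skii inequality for hyperbolic cross polynomials:
`‖f‖_∞ ≤ C(q,γ) 2^{n/q} n^{(ν-1)(1-1/q)} ‖f‖_q` for all `f ∈ T(Q_n^γ)`. -/
theorem stmt_15 (d ν : ℕ) (γ : Fin d → ℝ) (q : ℝ) (hq : 1 ≤ q)
    (hν : 1 ≤ ν) (hνd : ν ≤ d)
    (hγ1 : ∀ j : Fin d, (j : ℕ) < ν → γ j = 1)
    (hγ2 : ∀ j : Fin d, ν ≤ (j : ℕ) → 1 < γ j)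
    (hγmono : Monotone γ) :
    ∃ C : ℝ, 0 < C ∧
      ∀ n : ℕ, 1 ≤ n →
        ∀ f : (Fin d → ℝ) → ℂ, IsTrigPoly d (hyperbolicCross d γ n) f →
          torusSupC d f ≤
            C * (2 : ℝ) ^ ((n : ℝ) / q) * (n : ℝ) ^ (((ν : ℝ) - 1) * (1 - 1 / q)) *
              torusLq d q f := by
  exact hc_final d ν γ q hq hν hνd hγ1 hγ2
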